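/- arXiv:1509.04998 — 5 statements merged into one kernel-verified Lean document; each statement's English description precedes it below -/
import Mathlib

section
/- Let ε ∈ (0,1) and let n be an integer satisfying ⌈(log(n)+1)²⌉ < ⌈n^ε⌉ ≤ n − 2⌈log(n)⌉. Then the proportion p(n,ε) of elements g of the symmetric group S_n such that g has even order and g^{|g|/2} is an involution whose support has cardinality at most ⌈n^ε⌉ satisfies p(n,ε) > ε/48. -/
/-- The proportion of elements `g` of the symmetric group `Sₙ` such that `g` has even
order and `g^(|g|/2)` is an involution whose support has cardinality at most `⌈n^ε⌉`. -/
noncomputable def symPropn (n : ℕ) (ε : ℝ) : ℝ :=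
  (Nat.card {g : Equiv.Perm (Fin n) //
      Even (orderOf g) ∧ orderOf (g ^ (orderOf g / 2)) = 2 ∧
      (((g ^ (orderOf g / 2)).support.card : ℤ) ≤ ⌈(n : ℝ) ^ ε⌉)} : ℝ) /
    Nat.card (Equiv.Perm (Fin n))

instance auxDisjDec {α : Type*} [Fintype α] [DecidableEq α] (c h : Equiv.Perm α) :
    Decidable (Equiv.Perm.Disjoint c h) :=
  inferInstanceAs (Decidable (∀ x, c x = x ∨ h x = x))

open Equiv Equiv.Perm Finset Nat in
lemma aux_cyc_card {α : Type*} [Fintype α] [DecidableEq α] (l : ℕ) (h2 : 2 ≤ l)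
    (hl : l ≤ Fintype.card α) :
    ((#({c | c.cycleType = {l}} : Finset (Perm α)) : ℕ) : ℝ) * ((Fintype.card α - l)! : ℝ)
      = ((Fintype.card α)! : ℝ) * (1 / (l : ℝ)) := by
  have h := card_of_cycleType_mul_eq α {l}
  simp only [Multiset.sum_singleton, Multiset.prod_singleton, Multiset.mem_singleton, forall_eq,
    Multiset.toFinset_singleton, Finset.prod_singleton, Multiset.count_singleton_self,
    Nat.factorial_one, mul_one, hl, h2, and_self, if_true] at h
  have h' := congrArg (Nat.cast : ℕ → ℝ) h
  push_cast at h'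
  have : (l : ℝ) ≠ 0 := by positivity
  field_simp
  linarith

open Equiv Equiv.Perm Finset Nat in
lemma aux_disj_iff {α : Type*} [Fintype α] [DecidableEq α] (c f : Perm α) :
    (∀ a, ¬ (a ∉ c.support) → f a = a) ↔ Perm.Disjoint c f := by
  unfold Perm.Disjoint
  refine forall_congr' fun a => ?_
  simp only [mem_support]
  tauto

open Equiv Equiv.Perm Finset Nat in
lemma aux_disj_card {α : Type*} [Fintype α] [DecidableEq α] (c : Perm α) :
    #({h | Perm.Disjoint c h} : Finset (Perm α)) ≤ (Fintype.card α - #c.support)! := by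
  classical
  have e := Fintype.card_congr (Perm.subtypeEquivSubtypePerm (fun a => a ∉ c.support))
  rw [Fintype.card_perm] at e
  have h1 : Fintype.card {a // a ∉ c.support} = Fintype.card α - #c.support := by
    rw [Fintype.card_subtype_compl, Fintype.card_coe]
  rw [h1] at e
  rw [e, Fintype.card_subtype]
  apply Finset.card_le_card
  intro h hh
  simp only [mem_filter, mem_univ, true_and] at hh ⊢
  exact (aux_disj_iff c h).2 hh

open Equiv Equiv.Perm Finset Nat in
lemma aux_disj_card_ge {α : Type*} [Fintype α] [DecidableEq α] (c : Perm α) (t : ℕ) :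
    #({h | ∀ k ∈ h.cycleType, ¬ t ∣ k} : Finset (Perm {a // a ∉ c.support})) ≤
    #({h | Perm.Disjoint c h ∧ ∀ k ∈ h.cycleType, ¬ t ∣ k} : Finset (Perm α)) := by
  classical
  refine Finset.card_le_card_of_injOn (fun h => ofSubtype h) ?_ ?_
  · intro h hh
    simp only [coe_filter, mem_univ, true_and, Set.mem_ofPred_eq] at hh ⊢
    refine ⟨(aux_disj_iff c _).1 fun a ha => ofSubtype_apply_of_not_mem _ ha, ?_⟩
    rw [cycleType_ofSubtype]
    exact hh
  · exact (ofSubtype_injective).injOn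

open Equiv Equiv.Perm Finset Nat in
lemma aux_bad {α : Type*} [Fintype α] [DecidableEq α] (t : ℕ) (ht : 2 ≤ t) :
    ((#({h | ¬ ∀ k ∈ h.cycleType, ¬ t ∣ k} : Finset (Perm α)) : ℕ) : ℝ) ≤
      ((Fintype.card α)! : ℝ) * ∑ j ∈ Icc 1 (Fintype.card α / t), 1 / (((t * j : ℕ)) : ℝ) := by
  classical
  have hsub : ({h | ¬ ∀ k ∈ h.cycleType, ¬ t ∣ k} : Finset (Perm α)) ⊆
      (Icc 1 (Fintype.card α / t)).biUnion fun j =>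
        ({c | c.cycleType = {t * j}} : Finset (Perm α)).biUnion fun c =>
          ({h | Perm.Disjoint c h} : Finset (Perm α)).image (fun h => c * h) := by
    intro g hg
    simp only [mem_filter, mem_univ, true_and, not_forall, not_not] at hg
    obtain ⟨k, hk, j, rfl⟩ := hg
    have h2 := two_le_of_mem_cycleType hk
    have hle := (le_card_support_of_mem_cycleType hk).trans (Finset.card_le_univ _)
    obtain ⟨c, τ, rfl, hd, hc, hcard⟩ := mem_cycleType_iff.1 hk
    simp only [mem_biUnion, mem_filter, mem_univ, true_and, mem_image, mem_Icc]
    refine ⟨j, ⟨?_, ?_⟩, c, ?_, τ, hd, rfl⟩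
    · rcases Nat.eq_zero_or_pos j with h | h
      · subst h; omega
      · exact h
    · rw [Nat.le_div_iff_mul_le (by omega), mul_comm]; exact hle
    · rw [hc.cycleType, hcard]
  have hN := (Finset.card_le_card hsub).trans card_biUnion_le
  refine (Nat.cast_le (α := ℝ).2 hN).trans ?_
  rw [Nat.cast_sum, Finset.mul_sum]
  refine Finset.sum_le_sum fun j hj => ?_
  rw [mem_Icc] at hj
  have hle : t * j ≤ Fintype.card α := by
    rw [mul_comm]; exact (Nat.le_div_iff_mul_le (by omega)).1 hj.2
  rw [← aux_cyc_card (α := α) (t * j) (by nlinarith) hle]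
  rw [← Nat.cast_mul, Nat.cast_le]
  refine card_biUnion_le.trans ?_
  refine Finset.sum_le_card_nsmul _ _ _ fun c hc => ?_
  refine card_image_le.trans ((aux_disj_card c).trans ?_)
  simp only [mem_filter, mem_univ, true_and] at hc
  rw [← sum_cycleType c, hc, Multiset.sum_singleton]

open Equiv Equiv.Perm Finset Nat in
lemma aux_good {α : Type*} [Fintype α] [DecidableEq α] (t : ℕ) (ht : 2 ≤ t) :
    ((Fintype.card α)! : ℝ) * (1 - ∑ j ∈ Icc 1 (Fintype.card α / t), 1 / (((t * j : ℕ)) : ℝ)) ≤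
    ((#({h | ∀ k ∈ h.cycleType, ¬ t ∣ k} : Finset (Perm α)) : ℕ) : ℝ) := by
  classical
  have h := aux_bad (α := α) t ht
  have h3 := Finset.card_filter_add_card_filter_not (s := (Finset.univ : Finset (Perm α)))
    (fun h => ∀ k ∈ h.cycleType, ¬ t ∣ k)
  rw [Finset.card_univ, Fintype.card_perm] at h3
  have h4 := congrArg (Nat.cast : ℕ → ℝ) h3
  push_cast at h4 h ⊢
  linarith

open Equiv Equiv.Perm Finset Nat in
lemma aux_count {α : Type*} [Fintype α] [DecidableEq α] (t M : ℕ) (ht : 2 ≤ t)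
    (hM : M ≤ Fintype.card α) (P : Perm α → Prop) [DecidablePred P]
    (hP : ∀ c h : Perm α, ∀ j, c.cycleType = {t * j} → t * j ≤ M → Perm.Disjoint c h →
      (∀ k ∈ h.cycleType, ¬ t ∣ k) → P (c * h))
    (hmu : ∑ j ∈ Icc 1 (Fintype.card α / t), 1 / (((t * j : ℕ)) : ℝ) ≤ 1 / 2) :
    ((Fintype.card α)! : ℝ) * ((∑ j ∈ Icc 1 (M / t), 1 / (((t * j : ℕ)) : ℝ)) * (1 / 2)) ≤
    ((#({g | P g} : Finset (Perm α)) : ℕ) : ℝ) := by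
  classical
  let S : Finset (Σ _ : Σ _ : ℕ, Perm α, Perm α) :=
    ((Icc 1 (M / t)).sigma fun j => ({c | c.cycleType = {t * j}} : Finset (Perm α))).sigma
      fun jc => ({h | Perm.Disjoint jc.2 h ∧ ∀ k ∈ h.cycleType, ¬ t ∣ k} : Finset (Perm α))
  have key : #S ≤ #({g | P g} : Finset (Perm α)) := by
    refine Finset.card_le_card_of_injOn (fun x => x.1.2 * x.2) ?_ ?_
    · rintro ⟨⟨j, c⟩, h⟩ hx
      simp only [S, coe_sigma, Set.mem_sigma_iff, mem_coe, mem_filter, mem_univ, true_and,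
        mem_sigma, mem_Icc] at hx ⊢
      refine hP c h j hx.1.2 ?_ hx.2.1 hx.2.2
      rw [mul_comm]; exact (Nat.le_div_iff_mul_le (by omega)).1 hx.1.1.2
    · rintro ⟨⟨j, c⟩, h⟩ hx ⟨⟨j', c'⟩, h'⟩ hx' heq
      simp only [S, mem_coe, mem_filter, mem_univ, true_and,
        mem_sigma, mem_Icc] at hx hx' heq
      obtain ⟨⟨hj, hc⟩, hd, hh⟩ := hx
      obtain ⟨⟨hj', hc'⟩, hd', hh'⟩ := hx'
      have cy : c.IsCycle := by rw [← card_cycleType_eq_one, hc]; simp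
      have cy' : c'.IsCycle := by rw [← card_cycleType_eq_one, hc']; simp
      have hmem : c ∈ (c * h).cycleFactorsFinset := by
        rw [hd.cycleFactorsFinset_mul_eq_union, cy.cycleFactorsFinset_eq_singleton]; simp
      rw [heq, hd'.cycleFactorsFinset_mul_eq_union, cy'.cycleFactorsFinset_eq_singleton,
        mem_union, mem_singleton] at hmem
      rcases hmem with rfl | hm
      · have : h = h' := mul_left_cancel heq
        subst this
        have : j = j' := by
          rw [hc] at hc'
          have := Multiset.singleton_inj.1 hc'
          exact Nat.eq_of_mul_eq_mul_left (by omega) this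
        subst this
        rfl
      · exfalso
        have hle := Multiset.mem_of_le (cycleType_le_of_mem_cycleFactorsFinset hm)
          (a := t * j) (by rw [hc]; simp)
        exact hh' _ hle (Dvd.intro _ rfl)
  refine le_trans ?_ (Nat.cast_le (α := ℝ).2 key)
  rw [Finset.card_sigma, Finset.sum_sigma, Nat.cast_sum, Finset.sum_mul, Finset.mul_sum]
  refine Finset.sum_le_sum fun j hj => ?_
  rw [mem_Icc] at hj
  have hle : t * j ≤ Fintype.card α := by
    rw [mul_comm]; exact ((Nat.le_div_iff_mul_le (by omega)).1 hj.2).trans hM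
  rw [← mul_assoc, ← aux_cyc_card (α := α) (t * j) (by nlinarith) hle, Nat.cast_sum, mul_assoc,
    ← nsmul_eq_mul, ← Finset.sum_const]
  refine Finset.sum_le_sum fun c hc => ?_
  simp only [mem_filter, mem_univ, true_and] at hc
  refine le_trans ?_ (Nat.cast_le (α := ℝ).2 (aux_disj_card_ge c t))
  refine le_trans ?_ (aux_good t ht)
  have hs : #c.support = t * j := by rw [← sum_cycleType c, hc, Multiset.sum_singleton]
  have h1 : Fintype.card {a // a ∉ c.support} = Fintype.card α - t * j := by
    rw [Fintype.card_subtype_compl, Fintype.card_coe, hs]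
  rw [h1]
  gcongr
  have : ∑ i ∈ Icc 1 ((Fintype.card α - t * j) / t), 1 / (((t * i : ℕ)) : ℝ) ≤
      ∑ i ∈ Icc 1 (Fintype.card α / t), 1 / (((t * i : ℕ)) : ℝ) := by
    refine Finset.sum_le_sum_of_subset_of_nonneg ?_ fun _ _ _ => by positivity
    apply Finset.Icc_subset_Icc le_rfl
    exact Nat.div_le_div_right (Nat.sub_le _ _)
  linarith

lemma aux_pow_lcm (k a b : ℕ) (ha : ¬ 2 ^ k ∣ a) (hb : ¬ 2 ^ k ∣ b) : ¬ 2 ^ k ∣ Nat.lcm a b := by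
  have ha0 : a ≠ 0 := by rintro rfl; simp at ha
  have hb0 : b ≠ 0 := by rintro rfl; simp at hb
  rw [Nat.prime_two.pow_dvd_iff_le_factorization ha0] at ha
  rw [Nat.prime_two.pow_dvd_iff_le_factorization hb0] at hb
  rw [Nat.prime_two.pow_dvd_iff_le_factorization (Nat.lcm_ne_zero ha0 hb0),
    Nat.factorization_lcm ha0 hb0]
  simp only [Finsupp.sup_apply, le_sup_iff]
  tauto

lemma aux_pow_mlcm (k : ℕ) (hk : 1 ≤ k) (s : Multiset ℕ) (h : ∀ x ∈ s, ¬ 2 ^ k ∣ x) :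
    ¬ 2 ^ k ∣ s.lcm := by
  induction s using Multiset.induction_on with
  | empty =>
    simp
    omega
  | cons a s ih =>
    rw [Multiset.lcm_cons]
    exact aux_pow_lcm k _ _ (h a (by simp)) (ih fun x hx => h x (by simp [hx]))

open Equiv Equiv.Perm Finset in
lemma aux_P {α : Type*} [Fintype α] [DecidableEq α] (k : ℕ) (hk : 1 ≤ k) (c h : Perm α) (j : ℕ)
    (hc : c.cycleType = {2 ^ k * j}) (hd : Perm.Disjoint c h)
    (hh : ∀ x ∈ h.cycleType, ¬ 2 ^ k ∣ x) :
    Even (orderOf (c * h)) ∧ orderOf ((c * h) ^ (orderOf (c * h) / 2)) = 2 ∧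
      #((c * h) ^ (orderOf (c * h) / 2)).support ≤ 2 ^ k * j := by
  have hb := aux_pow_mlcm k hk _ hh
  rw [lcm_cycleType] at hb
  have hoc : orderOf c = 2 ^ k * j := by rw [← lcm_cycleType, hc]; simp
  have hN := hd.orderOf
  have h2k : 2 ^ k ∣ orderOf (c * h) := by
    rw [hN, hoc]; exact (Dvd.intro _ rfl).trans (Nat.dvd_lcm_left _ _)
  have h2 : 2 ∣ orderOf (c * h) := (dvd_pow_self 2 (by omega)).trans h2k
  have hpos : 0 < orderOf (c * h) := orderOf_pos _
  refine ⟨even_iff_two_dvd.2 h2, ?_, ?_⟩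
  · obtain ⟨q, hq⟩ := h2
    rw [hq, Nat.mul_div_cancel_left _ (by norm_num)]
    rw [orderOf_pow_of_dvd (by omega) (by rw [hq]; exact Dvd.intro_left _ rfl), hq]
    exact Nat.mul_div_cancel _ (by omega)
  · have hbd : orderOf h ∣ orderOf (c * h) := by rw [hN]; exact Nat.dvd_lcm_right _ _
    obtain ⟨q, hq⟩ := hbd
    have hqe : 2 ∣ q := by
      by_contra hodd
      apply hb
      rw [hq] at h2k
      refine Nat.Coprime.dvd_of_dvd_mul_right ?_ h2k
      exact Nat.Coprime.pow_left _ ((Nat.Prime.coprime_iff_not_dvd Nat.prime_two).2 hodd)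
    obtain ⟨r, rfl⟩ := hqe
    have h1 : orderOf (c * h) / 2 = orderOf h * r := by
      rw [hq, Nat.mul_left_comm, Nat.mul_div_cancel_left _ (by norm_num)]
    have h3 : h ^ (orderOf (c * h) / 2) = 1 := by rw [h1, pow_mul, pow_orderOf_eq_one, one_pow]
    rw [hd.commute.mul_pow, h3, mul_one]
    refine (Finset.card_le_card (support_pow_le c _)).trans ?_
    rw [← sum_cycleType c, hc, Multiset.sum_singleton]

lemma aux_harm (t m : ℕ) :
    ∑ j ∈ Finset.Icc 1 m, 1 / (((t * j : ℕ)) : ℝ) = (harmonic m : ℝ) / t := by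
  rw [harmonic_eq_sum_Icc]
  push_cast
  rw [Finset.sum_div]
  refine Finset.sum_congr rfl fun j _ => ?_
  rw [one_div, mul_inv, div_eq_mul_inv, mul_comm]

theorem stmt0 (ε : ℝ) (hε : ε ∈ Set.Ioo (0 : ℝ) 1) (n : ℕ)
    (h1 : ⌈(Real.log n + 1) ^ 2⌉ < ⌈(n : ℝ) ^ ε⌉)
    (h2 : ⌈(n : ℝ) ^ ε⌉ ≤ (n : ℤ) - 2 * ⌈Real.log n⌉) :
    symPropn n ε > ε / 48 := by
  classical
  obtain ⟨hε0, hε1⟩ := hε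
  set L := Real.log n with hL
  have hL0 : 0 ≤ L := Real.log_natCast_nonneg n
  obtain ⟨M, hM⟩ : ∃ M : ℕ, (M : ℤ) = ⌈(n : ℝ) ^ ε⌉ :=
    ⟨_, Int.toNat_of_nonneg (Int.ceil_nonneg (by positivity))⟩
  have hMn : M ≤ n := by
    have := Int.ceil_nonneg hL0
    omega
  have hML : (L + 1) ^ 2 < M := by
    have ha := Int.le_ceil ((L + 1) ^ 2)
    have hb : ((⌈(L + 1) ^ 2⌉ : ℤ) : ℝ) < ((M : ℤ) : ℝ) := by rw [hM]; exact_mod_cast h1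
    rw [Int.cast_natCast] at hb
    linarith
  have hnM : (n : ℝ) ^ ε ≤ M := by
    have := Int.le_ceil ((n : ℝ) ^ ε)
    rw [← hM, Int.cast_natCast] at this
    exact this
  have hMnR : (M : ℝ) ≤ n := by exact_mod_cast hMn
  -- n ≥ 3, first n ≥ 2
  have hn2 : 1 < n := by
    have : (1 : ℝ) < n := by nlinarith
    exact_mod_cast this
  have hLh : (1 : ℝ) / 2 ≤ L := by
    have : Real.log 2 ≤ L := Real.log_le_log (by norm_num) (by exact_mod_cast hn2)
    linarith [Real.log_two_gt_d9]
  have hn3 : 3 ≤ n := by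
    have : (2 : ℝ) < n := by nlinarith
    exact_mod_cast this
  have hL1 : 1 < L := by
    rw [hL, Real.lt_log_iff_exp_lt (by positivity)]
    have : (3 : ℝ) ≤ n := by exact_mod_cast hn3
    linarith [Real.exp_one_lt_d9]
  obtain ⟨k0, hk1, hk2⟩ := exists_nat_pow_near (x := 2 * L) (y := 2) (by linarith) (by norm_num)
  have hk0 : 1 ≤ k0 := by
    rcases Nat.eq_zero_or_pos k0 with h | h
    · subst h; norm_num at hk2; linarith
    · exact h
  set t : ℕ := 2 ^ (k0 + 1) with ht
  have htR : (t : ℝ) = 2 ^ (k0 + 1) := by rw [ht]; push_cast; rfl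
  have ht1 : 2 * L < t := by rw [htR]; exact hk2
  have ht2 : (t : ℝ) ≤ 4 * L := by rw [htR, pow_succ]; linarith
  have ht4 : 4 ≤ t := by
    rw [ht]; calc 4 = 2 ^ (1 + 1) := by norm_num
      _ ≤ _ := Nat.pow_le_pow_right (by norm_num) (by omega)
  have ht4R : (4 : ℝ) ≤ t := by exact_mod_cast ht4
  have htM : (t : ℝ) ≤ M := by nlinarith [sq_nonneg (L - 1)]
  have htMN : t ≤ M := by exact_mod_cast htM
  have ht0 : (0 : ℝ) < t := by linarith
  have hM0 : (0 : ℝ) < M := by linarith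
  have hn0 : (0 : ℝ) < n := by linarith
  have hlog4 : Real.log 4 = 2 * Real.log 2 := by
    rw [show (4 : ℝ) = 2 ^ 2 by norm_num, Real.log_pow]; norm_num
  have hl2 := Real.log_two_gt_d9
  have hl2' := Real.log_two_lt_d9
  have hlogt : 1 ≤ Real.log t := by
    have := Real.log_le_log (by norm_num) ht4R
    linarith
  have hmu : (harmonic (n / t) : ℝ) / t ≤ 1 / 2 := by
    have hh := harmonic_floor_le_one_add_log ((n : ℝ) / t) (by rw [le_div_iff₀ ht0]; linarith)
    rw [Nat.floor_div_eq_div, Real.log_div hn0.ne' ht0.ne'] at hh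
    rw [div_le_iff₀ ht0]
    linarith
  have hH1 : (1 : ℝ) ≤ harmonic (M / t) := by
    have hpos : 1 ≤ M / t := (Nat.le_div_iff_mul_le (by omega)).2 (by omega)
    rw [harmonic_eq_sum_Icc]
    push_cast
    calc (1 : ℝ) = ((1 : ℕ) : ℝ)⁻¹ := by norm_num
      _ ≤ _ := Finset.single_le_sum (f := fun i : ℕ => ((i : ℝ))⁻¹)
          (fun i _ => by positivity) (Finset.mem_Icc.2 ⟨le_rfl, hpos⟩)
  have hH2 : Real.log M - Real.log t ≤ harmonic (M / t) := by
    have hh := log_le_harmonic_floor ((M : ℝ) / t) (by positivity)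
    rwa [Nat.floor_div_eq_div, Real.log_div hM0.ne' ht0.ne'] at hh
  have hlt : Real.log t ≤ Real.log 4 + Real.log M / 2 := by
    have ha : Real.log t ≤ Real.log 4 + Real.log L := by
      rw [← Real.log_mul (by norm_num) (by linarith)]
      exact Real.log_le_log ht0 ht2
    have hb : 2 * Real.log L ≤ Real.log M := by
      have : Real.log (L ^ 2) ≤ Real.log M := Real.log_le_log (by positivity) (by nlinarith)
      rw [Real.log_pow] at this
      exact_mod_cast this
    linarith
  have hH : Real.log M / 6 < harmonic (M / t) := by
    by_cases hc : Real.log M < 6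
    · linarith
    · push Not at hc
      linarith
  have heps : ε * L ≤ Real.log M := by
    rw [hL, ← Real.log_rpow hn0]
    exact Real.log_le_log (by positivity) hnM
  have hcount := aux_count (α := Fin n) t M (by omega) (by simpa using hMn)
    (fun g => Even (orderOf g) ∧ orderOf (g ^ (orderOf g / 2)) = 2 ∧
      (((g ^ (orderOf g / 2)).support.card : ℤ) ≤ ⌈(n : ℝ) ^ ε⌉))
    (by
      intro c h j hc hj hd hh
      obtain ⟨p1, p2, p3⟩ := aux_P (k0 + 1) (by omega) c h j hc hd hh
      refine ⟨p1, p2, ?_⟩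
      rw [← hM]
      exact_mod_cast p3.trans hj)
    (by rw [aux_harm, Fintype.card_fin]; exact hmu)
  rw [aux_harm, Fintype.card_fin] at hcount
  unfold symPropn
  rw [Nat.card_eq_fintype_card, Nat.card_eq_fintype_card, Fintype.card_perm, Fintype.card_fin,
    Fintype.card_subtype, gt_iff_lt, lt_div_iff₀ (by exact_mod_cast Nat.factorial_pos n)]
  refine lt_of_lt_of_le ?_ hcount
  rw [mul_comm]
  have hf : (0 : ℝ) < (n.factorial : ℝ) := by exact_mod_cast Nat.factorial_pos n
  refine mul_lt_mul_of_pos_left ?_ hf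
  rw [div_mul_eq_mul_div, lt_div_iff₀ ht0]
  have : ε * t ≤ ε * (4 * L) := mul_le_mul_of_nonneg_left ht2 hε0.le
  nlinarith
end

section
/- Let ε ∈ (0,1) and let n be an integer satisfying ⌈(log(n)+1)²⌉ < ⌈n^ε⌉ ≤ n − 2⌈log(n)⌉. Set K = ⌊⌈n^ε⌉/⌈log(n)⌉⌋. Then p(n,ε) ≥ Σ_{k odd, 1 ≤ k ≤ K} Σ_{a ≥ 1, 2^a ≤ ⌈log(n)⌉} s_{¬2^a}(n − 2^a·k)/(2^a·k). -/
/-- `sNot m ℓ` is the proportion of elements of `S_ℓ` having no cycle of length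
divisible by `m`. -/
noncomputable def sNot (m ℓ : ℕ) : ℝ :=
  (Nat.card {g : Equiv.Perm (Fin ℓ) // ∀ d ∈ g.cycleType, ¬ m ∣ d} : ℝ) /
    Nat.card (Equiv.Perm (Fin ℓ))

open Finset in
lemma aux_pow_dvd_lcm (a : ℕ) (ha : 1 ≤ a) (s : Multiset ℕ) (hs : ∀ d ∈ s, ¬ 2 ^ a ∣ d) :
    ¬ 2 ^ a ∣ s.lcm := by
  induction s using Multiset.induction with
  | empty =>
    simp
    omega
  | cons x s ih =>
    have hx := hs x (by simp)
    have hs' := ih (fun d hd => hs d (by simp [hd]))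
    rw [Multiset.lcm_cons]
    have hx0 : x ≠ 0 := by rintro rfl; simp at hx
    have hs0 : s.lcm ≠ 0 := by intro h; rw [h] at hs'; simp at hs'
    change ¬ 2 ^ a ∣ Nat.lcm x s.lcm
    rw [Nat.prime_two.pow_dvd_iff_le_factorization (Nat.lcm_ne_zero hx0 hs0),
      Nat.factorization_lcm hx0 hs0]
    rw [Nat.prime_two.pow_dvd_iff_le_factorization hx0] at hx
    rw [Nat.prime_two.pow_dvd_iff_le_factorization hs0] at hs'
    simp only [Finsupp.sup_apply, le_sup_iff]
    tauto

/-- the standard permutation: a cycle of length `d` next to `h`. -/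
def stdPerm (d r : ℕ) (h : Equiv.Perm (Fin r)) : Equiv.Perm (ZMod d ⊕ Fin r) :=
  Equiv.Perm.sumCongr (Equiv.addRight (1 : ZMod d)) h

lemma stdPerm_pow (d r : ℕ) (h : Equiv.Perm (Fin r)) (j : ℕ) :
    (stdPerm d r h) ^ j = Equiv.Perm.sumCongr (Equiv.addRight (j : ZMod d)) (h ^ j) := by
  induction j with
  | zero => ext x; rcases x with x | x <;> simp
  | succ j ih =>
    rw [pow_succ, ih]
    ext x
    rcases x with x | x
    · simp [stdPerm]; ring
    · simp [stdPerm, pow_succ]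

lemma stdPerm_pow_eq_one (d r : ℕ) (h : Equiv.Perm (Fin r)) (j : ℕ) :
    (stdPerm d r h) ^ j = 1 ↔ d ∣ j ∧ orderOf h ∣ j := by
  rw [stdPerm_pow, orderOf_dvd_iff_pow_eq_one, ← ZMod.natCast_eq_zero_iff]
  constructor
  · intro H
    constructor
    · have := congrArg (fun f => f (Sum.inl 0)) H
      simpa using this
    · ext x
      have := congrArg (fun f => f (Sum.inr x)) H
      simp at this
      rw [this]; rfl
  · rintro ⟨h1, h2⟩
    rw [h1, h2]
    ext x; rcases x with x | x <;> simp

lemma stdPerm_key (a k r : ℕ) (ha : 1 ≤ a) (hk : Odd k) (h : Equiv.Perm (Fin r))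
    (hh : ∀ d ∈ h.cycleType, ¬ 2 ^ a ∣ d) :
    Even (orderOf (stdPerm (2 ^ a * k) r h)) ∧
    (∀ x, ((stdPerm (2 ^ a * k) r h) ^ (orderOf (stdPerm (2 ^ a * k) r h) / 2)) (Sum.inl x)
      ≠ Sum.inl x) ∧
    (∀ x, ((stdPerm (2 ^ a * k) r h) ^ (orderOf (stdPerm (2 ^ a * k) r h) / 2)) (Sum.inr x)
      = Sum.inr x) := by
  have hk0 : 0 < k := hk.pos
  have hd0 : 0 < 2 ^ a * k := by positivity
  have : NeZero (2 ^ a * k) := ⟨hd0.ne'⟩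
  set u := stdPerm (2 ^ a * k) r h with hu
  have hO : (2 ^ a * k) ∣ orderOf u ∧ orderOf h ∣ orderOf u :=
    (stdPerm_pow_eq_one _ _ _ _).1 (pow_orderOf_eq_one u)
  have hpos : 0 < orderOf u := orderOf_pos u
  have h2a : ¬ 2 ^ a ∣ orderOf h := by
    rw [← Equiv.Perm.lcm_cycleType]
    exact aux_pow_dvd_lcm a ha _ hh
  have heven : 2 ∣ orderOf u :=
    ((dvd_pow_self 2 (by omega)).mul_right k).trans hO.1
  obtain ⟨M, hM⟩ := heven
  have hM2 : orderOf u / 2 = M := by omega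
  have hohM : orderOf h ∣ M := by
    obtain ⟨q, hq⟩ := hO.2
    rcases Nat.even_or_odd q with ⟨q', hq'⟩ | hodd
    · refine ⟨q', ?_⟩
      have : 2 * M = 2 * (orderOf h * q') := by rw [← hM, hq, hq']; ring
      omega
    · exfalso
      apply h2a
      have h1 : 2 ^ a ∣ orderOf h * q := hq ▸ (Dvd.intro _ rfl).trans hO.1
      exact Nat.Coprime.dvd_of_dvd_mul_right
        (Nat.Coprime.pow_left _ (Nat.coprime_two_left.2 hodd)) h1
  have hdM : ¬ (2 ^ a * k) ∣ M := by
    intro H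
    have := orderOf_dvd_of_pow_eq_one ((stdPerm_pow_eq_one _ _ _ _).2 ⟨H, hohM⟩)
    rw [← hu, hM] at this
    have := Nat.le_of_dvd (by omega) this
    omega
  refine ⟨⟨M, by omega⟩, ?_, ?_⟩
  · intro x
    rw [hM2, hu, stdPerm_pow]
    intro H
    apply hdM
    rw [← ZMod.natCast_eq_zero_iff]
    simpa using H
  · intro x
    rw [hM2, hu, stdPerm_pow, orderOf_dvd_iff_pow_eq_one.1 hohM]
    simp

lemma permCongr_pow' {α β : Type*} (σ : α ≃ β) (u : Equiv.Perm α) (j : ℕ) :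
    (σ.permCongr u) ^ j = σ.permCongr (u ^ j) := by
  have := map_pow σ.permCongrHom u j
  exact this.symm

lemma orderOf_permCongr' {α β : Type*} (σ : α ≃ β) (u : Equiv.Perm α) :
    orderOf (σ.permCongr u) = orderOf u :=
  MulEquiv.orderOf_eq σ.permCongrHom u

/-- The set of permutations of even order whose associated involution moves `d` points. -/
noncomputable def evSet (n d : ℕ) : Finset (Equiv.Perm (Fin n)) :=
  Finset.univ.filter fun g => Even (orderOf g) ∧ (g ^ (orderOf g / 2)).support.card = d

lemma key_mem_iff (n a k r : ℕ) (ha : 1 ≤ a) (hk : Odd k) (h : Equiv.Perm (Fin r))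
    (hh : ∀ d ∈ h.cycleType, ¬ 2 ^ a ∣ d) (σ : (ZMod (2 ^ a * k) ⊕ Fin r) ≃ Fin n)
    (g : Equiv.Perm (Fin n)) (hg : σ.permCongr (stdPerm (2 ^ a * k) r h) = g) :
    (∀ x, σ (Sum.inl x) ∈ (g ^ (orderOf g / 2)).support) ∧
    (∀ x, σ (Sum.inr x) ∉ (g ^ (orderOf g / 2)).support) ∧ Even (orderOf g) := by
  obtain ⟨h1, h2, h3⟩ := stdPerm_key a k r ha hk h hh
  subst hg
  rw [orderOf_permCongr', permCongr_pow']
  refine ⟨?_, ?_, h1⟩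
  · intro x
    simpa using h2 x
  · intro x
    simpa using h3 x

lemma key_card (n a k r : ℕ) (ha : 1 ≤ a) (hk : Odd k) (h : Equiv.Perm (Fin r))
    (hh : ∀ d ∈ h.cycleType, ¬ 2 ^ a ∣ d) (σ : (ZMod (2 ^ a * k) ⊕ Fin r) ≃ Fin n)
    (g : Equiv.Perm (Fin n)) (hg : σ.permCongr (stdPerm (2 ^ a * k) r h) = g) :
    (g ^ (orderOf g / 2)).support.card = 2 ^ a * k := by
  have hk0 : 0 < k := hk.pos
  have hd0 : 0 < 2 ^ a * k := by positivity
  have : NeZero (2 ^ a * k) := ⟨hd0.ne'⟩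
  obtain ⟨h1, h2, h3⟩ := key_mem_iff n a k r ha hk h hh σ g hg
  have : (g ^ (orderOf g / 2)).support
      = (Finset.univ : Finset (ZMod (2 ^ a * k))).image (fun x => σ (Sum.inl x)) := by
    ext y
    simp only [Finset.mem_image, Finset.mem_univ, true_and]
    constructor
    · intro hy
      obtain ⟨x, rfl⟩ := σ.surjective y
      rcases x with x | x
      · exact ⟨x, rfl⟩
      · exact absurd hy (h2 x)
    · rintro ⟨x, rfl⟩
      exact h1 x
  rw [this, Finset.card_image_of_injective, Finset.card_univ, ZMod.card]
  intro x y hxy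
  simpa using hxy

lemma conj_apply {d r n : ℕ} (σ : (ZMod d ⊕ Fin r) ≃ Fin n) (h : Equiv.Perm (Fin r))
    (g : Equiv.Perm (Fin n)) (hg : σ.permCongr (stdPerm d r h) = g) (j : ℕ) :
    σ (Sum.inl (j : ZMod d)) = (g ^ j) (σ (Sum.inl 0)) := by
  subst hg
  rw [permCongr_pow', stdPerm_pow]
  simp

open Classical in
lemma key_count (n a k r : ℕ) (ha : 1 ≤ a) (hk : Odd k) (hn : 2 ^ a * k + r = n) :
    n.factorial * Nat.card {g : Equiv.Perm (Fin r) // ∀ d ∈ g.cycleType, ¬ 2 ^ a ∣ d}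
      ≤ (2 ^ a * k * r.factorial) * (evSet n (2 ^ a * k)).card := by
  have hk0 : 0 < k := hk.pos
  have hd0 : 0 < 2 ^ a * k := by positivity
  have : NeZero (2 ^ a * k) := ⟨hd0.ne'⟩
  let G := {g : Equiv.Perm (Fin r) // ∀ d ∈ g.cycleType, ¬ 2 ^ a ∣ d}
  let E := (ZMod (2 ^ a * k) ⊕ Fin r) ≃ Fin n
  let Φ : E × G → Equiv.Perm (Fin n) := fun p => p.1.permCongr (stdPerm (2 ^ a * k) r p.2.1)
  have hcα : Fintype.card (ZMod (2 ^ a * k) ⊕ Fin r) = n := by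
    rw [Fintype.card_sum, ZMod.card, Fintype.card_fin, hn]
  have hE : Fintype.card E = n.factorial := by
    rw [Fintype.card_equiv (Fintype.equivFinOfCardEq hcα), hcα]
  have himg : (Finset.univ : Finset (E × G)).image Φ ⊆ evSet n (2 ^ a * k) := by
    intro g hg
    simp only [Finset.mem_image, Finset.mem_univ, true_and] at hg
    obtain ⟨⟨σ, h, hh⟩, hg⟩ := hg
    simp only [evSet, Finset.mem_filter, Finset.mem_univ, true_and]
    exact ⟨(key_mem_iff n a k r ha hk h hh σ g hg).2.2, key_card n a k r ha hk h hh σ g hg⟩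
  have hfib : ∀ g ∈ (Finset.univ : Finset (E × G)).image Φ,
      (Finset.univ.filter fun p => Φ p = g).card ≤ 2 ^ a * k * r.factorial := by
    intro g hg
    have hc : (g ^ (orderOf g / 2)).support.card = 2 ^ a * k := by
      have := himg hg
      simp only [evSet, Finset.mem_filter, Finset.mem_univ, true_and] at this
      exact this.2
    set t := (g ^ (orderOf g / 2)).support with ht
    let F : {p : E × G // Φ p = g} → {x // x ∈ t} × (Fin r ↪ {x // x ∉ t}) := fun p =>
      (⟨p.1.1 (Sum.inl 0), (key_mem_iff n a k r ha hk p.1.2.1 p.1.2.2 p.1.1 g p.2).1 0⟩,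
       ⟨fun j => ⟨p.1.1 (Sum.inr j),
          (key_mem_iff n a k r ha hk p.1.2.1 p.1.2.2 p.1.1 g p.2).2.1 j⟩, by
          intro x y hxy
          simpa using hxy⟩)
    have hF : Function.Injective F := by
      rintro ⟨⟨σ, h, hh⟩, hp⟩ ⟨⟨σ', h', hh'⟩, hp'⟩ heq
      have e1 : σ (Sum.inl 0) = σ' (Sum.inl 0) := by
        have := congrArg (fun q => (q.1 : Fin n)) heq
        exact this
      have e2 : ∀ j, σ (Sum.inr j) = σ' (Sum.inr j) := by
        intro j
        have := congrArg (fun q => ((q.2 j : {x // x ∉ t}) : Fin n)) heq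
        exact this
      have hσ : σ = σ' := by
        apply Equiv.ext
        rintro (x | x)
        · rw [← ZMod.natCast_zmod_val x, conj_apply σ h g hp, conj_apply σ' h' g hp', e1]
        · exact e2 x
      subst hσ
      have hst : stdPerm (2 ^ a * k) r h = stdPerm (2 ^ a * k) r h' :=
        σ.permCongr.injective (hp.trans hp'.symm)
      have : h = h' := by
        apply Equiv.ext
        intro x
        have := congrArg (fun f => f (Sum.inr x)) hst
        simpa [stdPerm] using this
      subst this
      rfl
    have := Fintype.card_le_of_injective F hF
    rw [Fintype.card_prod, Fintype.card_embedding_eq, Fintype.card_coe, hc, Fintype.card_fin,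
      Fintype.card_subtype_compl, Fintype.card_fin, Fintype.card_coe, hc,
      show n - 2 ^ a * k = r by omega, Nat.descFactorial_self, Fintype.card_subtype] at this
    exact this
  have h1 := Finset.card_le_mul_card_image (f := Φ) Finset.univ _ hfib
  rw [Finset.card_univ, Fintype.card_prod, hE] at h1
  rw [Nat.card_eq_fintype_card]
  exact h1.trans (Nat.mul_le_mul_left _ (Finset.card_le_card himg))

lemma key_real (n a k : ℕ) (ha : 1 ≤ a) (hk : Odd k) (hn : 2 ^ a * k ≤ n) :
    sNot (2 ^ a) (n - 2 ^ a * k) / ((2 : ℝ) ^ a * k)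
      ≤ ((evSet n (2 ^ a * k)).card : ℝ) / n.factorial := by
  have hk0 : 0 < k := hk.pos
  have h := key_count n a k (n - 2 ^ a * k) ha hk (by omega)
  unfold sNot
  rw [Nat.card_perm, Nat.card_fin, div_div, div_le_div_iff₀ (by positivity) (by positivity)]
  have h' := (Nat.cast_le (α := ℝ)).2 h
  push_cast at h' ⊢
  linarith

lemma pair_inj {a k a' k' : ℕ} (hk : Odd k) (hk' : Odd k') (h : 2 ^ a * k = 2 ^ a' * k') :
    a = a' ∧ k = k' := by
  have key : ∀ {a k a' k' : ℕ}, Odd k → 2 ^ a * k = 2 ^ a' * k' → a' ≤ a := by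
    intro a k a' k' hk h
    have h1 : 2 ^ a' ∣ 2 ^ a * k := ⟨k', h⟩
    have h2 : 2 ^ a' ∣ 2 ^ a := Nat.Coprime.dvd_of_dvd_mul_right
        (Nat.Coprime.pow_left _ (Nat.coprime_two_left.2 hk)) h1
    exact (Nat.pow_dvd_pow_iff_le_right (by norm_num)).1 h2
  have : a = a' := le_antisymm (key hk' h.symm) (key hk h)
  subst this
  exact ⟨rfl, Nat.eq_of_mul_eq_mul_left (by positivity) h⟩

theorem stmt5 (ε : ℝ) (hε : ε ∈ Set.Ioo (0 : ℝ) 1) (n : ℕ)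
    (h1 : ⌈(Real.log n + 1) ^ 2⌉ < ⌈(n : ℝ) ^ ε⌉)
    (h2 : ⌈(n : ℝ) ^ ε⌉ ≤ (n : ℤ) - 2 * ⌈Real.log n⌉)
    (K : ℕ) (hK : (K : ℤ) = ⌈(n : ℝ) ^ ε⌉ / ⌈Real.log n⌉) :
    symPropn n ε ≥
      ∑ k ∈ (Finset.Icc 1 K).filter (fun k => Odd k),
        ∑ a ∈ Finset.Icc 1 (Nat.log 2 ⌈Real.log n⌉.toNat),
          sNot (2 ^ a) (n - 2 ^ a * k) / ((2 : ℝ) ^ a * k) := by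
  classical
  rw [← Finset.sum_product', ge_iff_le]
  set L := ⌈Real.log n⌉ with hL
  set N := ⌈(n : ℝ) ^ ε⌉ with hN
  set I := ((Finset.Icc 1 K).filter (fun k => Odd k)) ×ˢ Finset.Icc 1 (Nat.log 2 L.toNat) with hI
  have hL0 : 0 ≤ L := Int.ceil_nonneg (Real.log_natCast_nonneg n)
  have hmem : ∀ p ∈ I, Odd p.1 ∧ 1 ≤ p.2 ∧ ((2 ^ p.2 * p.1 : ℕ) : ℤ) ≤ N := by
    rintro ⟨k, a⟩ hp
    simp only [hI, Finset.mem_product, Finset.mem_filter, Finset.mem_Icc] at hp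
    obtain ⟨⟨⟨hk1, hkK⟩, hodd⟩, ha1, haL⟩ := hp
    refine ⟨hodd, ha1, ?_⟩
    have hLne : L.toNat ≠ 0 := by
      intro h0
      rw [h0] at haL
      simp at haL
      omega
    have hpow : 2 ^ a ≤ L.toNat := Nat.pow_le_of_le_log hLne haL
    have hpowZ : ((2 ^ a : ℕ) : ℤ) ≤ L := by omega
    have hkZ : (k : ℤ) ≤ N / L := by rw [← hK]; exact_mod_cast hkK
    calc ((2 ^ a * k : ℕ) : ℤ) = ((2 ^ a : ℕ) : ℤ) * k := by push_cast; ring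
      _ ≤ L * (N / L) := by gcongr
      _ ≤ N := Int.mul_ediv_self_le (by omega)
  have hstep : ∑ p ∈ I, sNot (2 ^ p.2) (n - 2 ^ p.2 * p.1) / ((2 : ℝ) ^ p.2 * p.1)
      ≤ ∑ p ∈ I, ((evSet n (2 ^ p.2 * p.1)).card : ℝ) / n.factorial := by
    apply Finset.sum_le_sum
    intro p hp
    obtain ⟨ho, ha, hle⟩ := hmem p hp
    exact key_real n p.2 p.1 ha ho (by omega)
  refine hstep.trans ?_
  rw [← Finset.sum_div]
  unfold symPropn
  rw [Nat.card_perm, Nat.card_fin]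
  gcongr
  rw [Nat.card_eq_fintype_card, Fintype.card_subtype, ← Nat.cast_sum, Nat.cast_le,
    ← Finset.card_biUnion]
  · apply Finset.card_le_card
    intro g hg
    simp only [Finset.mem_biUnion, evSet, Finset.mem_filter, Finset.mem_univ, true_and] at hg ⊢
    obtain ⟨p, hp, hev, hc⟩ := hg
    refine ⟨hev, orderOf_pow_orderOf_div (orderOf_pos g).ne' hev.two_dvd, ?_⟩
    rw [hc]
    exact (hmem p hp).2.2
  · intro p hp q hq hpq
    rw [Function.onFun, Finset.disjoint_left]
    intro g hg hg'
    simp only [evSet, Finset.mem_filter, Finset.mem_univ, true_and] at hg hg'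
    apply hpq
    have := pair_inj (hmem p hp).1 (hmem q hq).1 (hg.2.symm.trans hg'.2)
    exact Prod.ext this.2 this.1
end

section
/- Let ε ∈ (0,1) and let n be an integer satisfying ⌈(log(n)+1)²⌉ < ⌈n^ε⌉ ≤ n − 2⌈log(n)⌉. Set K = ⌊⌈n^ε⌉/⌈log(n)⌉⌋. Then p(n,ε) > (1/4) · (Σ_{k odd, 1 ≤ k ≤ K} 1/k) · (Σ_{a ≥ 1, 2^a ≤ ⌈log(n)⌉} 1/(2^a · n^{1/2^a})). -/
/-- centralizer order -/
def zz (m : Multiset ℕ) : ℕ := m.prod * ∏ i ∈ m.toFinset, (m.count i).factorial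

lemma zz_eq (m : Multiset ℕ) (T : Finset ℕ) (hT : m.toFinset ⊆ T) :
    zz m = m.prod * ∏ i ∈ T, (m.count i).factorial := by
  unfold zz
  congr 1
  apply Finset.prod_subset hT
  intro i _ hi
  rw [Multiset.mem_toFinset] at hi
  simp [Multiset.count_eq_zero_of_notMem hi]

lemma zz_cons (j : ℕ) (m : Multiset ℕ) : zz (j ::ₘ m) = j * (m.count j + 1) * zz m := by
  have h1 := zz_eq (j ::ₘ m) (insert j m.toFinset) (by simp)
  have h2 := zz_eq m (insert j m.toFinset) (by simp)
  rw [h1, h2, ← Finset.mul_prod_erase _ _ (Finset.mem_insert_self j _),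
    ← Finset.mul_prod_erase (insert j m.toFinset) (fun i => (m.count i).factorial)
      (Finset.mem_insert_self j _), Multiset.count_cons_self, Nat.factorial_succ,
      Multiset.prod_cons]
  have : ∏ x ∈ (insert j m.toFinset).erase j, (Multiset.count x (j ::ₘ m)).factorial
      = ∏ x ∈ (insert j m.toFinset).erase j, (Multiset.count x m).factorial := by
    apply Finset.prod_congr rfl
    intro x hx
    rw [Multiset.count_cons_of_ne (Finset.ne_of_mem_erase hx)]
  rw [this]; ring

lemma zz_pos (m : Multiset ℕ) (h : ∀ i ∈ m, 0 < i) : 0 < zz m := by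
  unfold zz
  apply Nat.mul_pos
  · exact Nat.pos_of_ne_zero (fun h0 => by
      rw [Multiset.prod_eq_zero_iff] at h0; exact absurd (h 0 h0) (by simp))
  · exact Finset.prod_pos fun i _ => Nat.factorial_pos _

/-- partitions of n with no part divisible by r, as multisets -/
def SS (r n : ℕ) : Finset (Multiset ℕ) :=
  ((Finset.univ : Finset (Nat.Partition n)).image Nat.Partition.parts).filter
    (fun m => ∀ i ∈ m, ¬ r ∣ i)

lemma mem_SS {r n : ℕ} {m : Multiset ℕ} :
    m ∈ SS r n ↔ m.sum = n ∧ (∀ i ∈ m, 0 < i) ∧ ∀ i ∈ m, ¬ r ∣ i := by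
  unfold SS
  rw [Finset.mem_filter, Finset.mem_image, ← and_assoc]
  refine and_congr_left fun _ => ?_
  constructor
  · rintro ⟨p, _, rfl⟩
    exact ⟨p.parts_sum, fun i hi => p.parts_pos hi⟩
  · rintro ⟨h1, h2⟩
    exact ⟨⟨m, fun {i} hi => h2 i hi, h1⟩, Finset.mem_univ _, rfl⟩

noncomputable def qq (r n : ℕ) : ℝ := ∑ m ∈ SS r n, (1 : ℝ) / zz m

lemma qq_rec (r n : ℕ) :
    (n : ℝ) * qq r n = ∑ j ∈ (Finset.Icc 1 n).filter (fun j => ¬ r ∣ j), qq r (n - j) := by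
  have e1 : (n : ℝ) * qq r n =
      ∑ x ∈ (SS r n).sigma (fun m => m.toFinset), (x.2 * x.1.count x.2 : ℝ) / zz x.1 := by
    rw [Finset.sum_sigma, qq, Finset.mul_sum]
    apply Finset.sum_congr rfl
    intro m hm
    rw [mem_SS] at hm
    have : n = ∑ i ∈ m.toFinset, m.count i * i := by
      conv_lhs => rw [← hm.1, Finset.sum_multiset_count]
      simp
    simp only
    rw [← Finset.sum_div, mul_one_div]
    congr 1
    conv_lhs => rw [this]
    push_cast
    exact Finset.sum_congr rfl fun i _ => mul_comm _ _
  have e2 : ∑ j ∈ (Finset.Icc 1 n).filter (fun j => ¬ r ∣ j), qq r (n - j) =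
      ∑ x ∈ ((Finset.Icc 1 n).filter (fun j => ¬ r ∣ j)).sigma (fun j => SS r (n - j)),
        (1 : ℝ) / zz x.2 := by
    rw [Finset.sum_sigma]; rfl
  rw [e1, e2]
  refine Finset.sum_bij' (fun x _ => ⟨x.2, x.1.erase x.2⟩) (fun x _ => ⟨x.1 ::ₘ x.2, x.1⟩)
    ?_ ?_ ?_ ?_ ?_
  · rintro ⟨m, j⟩ h
    simp only [Finset.mem_sigma, mem_SS, Multiset.mem_toFinset, Finset.mem_filter,
      Finset.mem_Icc] at h ⊢
    obtain ⟨⟨h1, h2, h3⟩, h4⟩ := h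
    have hs : j + (m.erase j).sum = n := by
      rw [← h1]; exact Multiset.sum_erase h4
    have := h2 j h4
    exact ⟨⟨⟨by omega, by omega⟩, h3 j h4⟩, by omega,
      fun i hi => h2 i (Multiset.mem_of_mem_erase hi),
      fun i hi => h3 i (Multiset.mem_of_mem_erase hi)⟩
  · rintro ⟨j, m⟩ h
    simp only [Finset.mem_sigma, mem_SS, Multiset.mem_toFinset, Finset.mem_filter,
      Finset.mem_Icc, Multiset.sum_cons, Multiset.mem_cons] at h ⊢
    obtain ⟨⟨⟨h1, h2⟩, h3⟩, h4, h5, h6⟩ := h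
    refine ⟨⟨by omega, ?_, ?_⟩, by simp⟩
    · rintro i (rfl | hi)
      · omega
      · exact h5 i hi
    · rintro i (rfl | hi)
      · exact h3
      · exact h6 i hi
  · rintro ⟨m, j⟩ h
    simp only [Finset.mem_sigma, Multiset.mem_toFinset] at h
    simp [Multiset.cons_erase h.2]
  · rintro ⟨j, m⟩ h
    simp
  · rintro ⟨m, j⟩ h
    simp only [Finset.mem_sigma, Multiset.mem_toFinset, mem_SS] at h
    obtain ⟨⟨h1, h2, h3⟩, h4⟩ := h
    have hz := zz_cons j (m.erase j)
    rw [Multiset.cons_erase h4] at hz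
    have hc : m.count j = (m.erase j).count j + 1 := by
      conv_lhs => rw [← Multiset.cons_erase h4, Multiset.count_cons_self]
    have hp := zz_pos (m.erase j) (fun i hi => h2 i (Multiset.mem_of_mem_erase hi))
    have hj := h2 j h4
    simp only
    rw [hz, hc]
    push_cast
    have : (0:ℝ) < zz (m.erase j) := by exact_mod_cast hp
    have : (0:ℝ) < j := by exact_mod_cast hj
    have : (0:ℝ) < (m.erase j).count j + 1 := by positivity
    field_simp

noncomputable def cc (r M : ℕ) : ℝ := ∏ i ∈ Finset.range M, (1 - 1 / ((r : ℝ) * (i + 1)))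

lemma sum_flip (r n : ℕ) (f : ℕ → ℝ) :
    ∑ j ∈ (Finset.Icc 1 n).filter (fun j => ¬ r ∣ j), f (n - j) =
      ∑ t ∈ (Finset.range n).filter (fun t => ¬ r ∣ (n - t)), f t := by
  refine Finset.sum_bij' (fun j _ => n - j) (fun t _ => n - t) ?_ ?_ ?_ ?_ ?_
  · intro j hj
    simp only [Finset.mem_filter, Finset.mem_Icc, Finset.mem_range] at hj ⊢
    refine ⟨by omega, ?_⟩
    rw [Nat.sub_sub_self hj.1.2]; exact hj.2
  · intro j hj
    simp only [Finset.mem_filter, Finset.mem_Icc, Finset.mem_range] at hj ⊢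
    exact ⟨by omega, hj.2⟩
  · intro j hj
    simp only [Finset.mem_filter, Finset.mem_Icc] at hj
    omega
  · intro j hj
    simp only [Finset.mem_filter, Finset.mem_range] at hj
    omega
  · intro j hj; rfl

lemma sum_step (r n : ℕ) (hr : 0 < r) (f : ℕ → ℝ) :
    ∑ t ∈ (Finset.range (n + r)).filter (fun t => ¬ r ∣ (n + r - t)), f t =
    ∑ t ∈ (Finset.range n).filter (fun t => ¬ r ∣ (n - t)), f t
      + ∑ t ∈ Finset.Ioo n (n + r), f t := by
  rw [← Finset.sum_union]
  · apply Finset.sum_congr _ (fun _ _ => rfl)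
    ext t
    simp only [Finset.mem_filter, Finset.mem_range, Finset.mem_union, Finset.mem_Ioo]
    rcases lt_trichotomy t n with h | h | h
    · have : n + r - t = (n - t) + r := by omega
      rw [this, Nat.dvd_add_self_right]
      constructor
      · rintro ⟨_, h⟩; left; exact ⟨by omega, h⟩
      · rintro (⟨_, h⟩ | h)
        · exact ⟨by omega, h⟩
        · omega
    · subst h; simp
    · constructor
      · rintro ⟨h, _⟩; right; omega
      · rintro (h' | h')
        · omega
        · refine ⟨by omega, fun hd => ?_⟩
          have := Nat.le_of_dvd (by omega) hd
          omega
  · rw [Finset.disjoint_left]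
    intro t h1 h2
    simp only [Finset.mem_filter, Finset.mem_range, Finset.mem_Ioo] at h1 h2
    omega

lemma qq_eq (r : ℕ) (hr : 0 < r) (n : ℕ) : qq r n = cc r (n / r) := by
  induction n using Nat.strong_induction_on with
  | _ n ih =>
  by_cases hnr : n < r
  · rcases Nat.eq_zero_or_pos n with rfl | hn
    · have : SS r 0 = {0} := by
        ext m
        rw [mem_SS, Finset.mem_singleton]
        constructor
        · rintro ⟨h1, h2, h3⟩
          rw [Multiset.eq_zero_iff_forall_notMem]
          intro a ha
          have := h2 a ha
          have := Multiset.single_le_sum (fun _ _ => Nat.zero_le _) a ha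
          omega
        · rintro rfl; simp
      simp [qq, cc, this, zz]
    · have h := qq_rec r n
      rw [sum_flip] at h
      have h' : ∑ t ∈ (Finset.range n).filter (fun t => ¬ r ∣ (n - t)), qq r t = n := by
        rw [Finset.filter_true_of_mem, Finset.sum_congr rfl (g := fun _ => (1:ℝ))]
        · simp
        · intro t ht
          rw [Finset.mem_range] at ht
          rw [ih t ht, Nat.div_eq_of_lt (by omega)]; simp [cc]
        · intro t ht hd
          rw [Finset.mem_range] at ht
          have := Nat.le_of_dvd (by omega) hd
          omega
      rw [h'] at h
      rw [Nat.div_eq_of_lt hnr]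
      have hn' : (n:ℝ) ≠ 0 := by positivity
      simp only [cc, Finset.range_zero, Finset.prod_empty]
      exact mul_left_cancel₀ hn' (by rw [h, mul_one])
  · obtain ⟨m, rfl⟩ : ∃ m, n = m + r := ⟨n - r, by omega⟩
    have h := qq_rec r (m + r)
    have h0 := qq_rec r m
    rw [sum_flip] at h h0
    rw [sum_step r m hr, ← h0, ih m (by omega)] at h
    set M := m / r with hM
    set b := m % r with hb
    have hm : m = r * M + b := (Nat.div_add_mod m r).symm
    have hbr : b < r := Nat.mod_lt _ hr
    have hsum : ∑ t ∈ Finset.Ioo m (m + r), qq r t = (r - 1 - b) * cc r M + b * cc r (M + 1) := by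
      have : Finset.Ioo m (m + r) = Finset.Ioo m (r * (M + 1)) ∪ Finset.Ico (r * (M + 1)) (m + r) := by
        ext t
        simp only [Finset.mem_union, Finset.mem_Ioo, Finset.mem_Ico]
        have : r * (M + 1) = r * M + r := by ring
        omega
      rw [this, Finset.sum_union]
      · have e1 : r * (M + 1) = r * M + r := by ring
        congr 1
        · rw [Finset.sum_congr rfl (g := fun _ => cc r M)]
          · rw [Finset.sum_const, Nat.card_Ioo, nsmul_eq_mul]
            have : r * (M + 1) - m - 1 = r - 1 - b := by omega
            rw [this, Nat.sub_sub, Nat.cast_sub (by omega)]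
            push_cast; ring
          · intro t ht
            rw [Finset.mem_Ioo] at ht
            rw [ih t (by omega)]
            congr 1
            rw [Nat.div_eq_iff hr]
            have : M * r = r * M := mul_comm _ _
            omega
        · rw [Finset.sum_congr rfl (g := fun _ => cc r (M + 1))]
          · rw [Finset.sum_const, Nat.card_Ico, nsmul_eq_mul]
            congr 2
            omega
          · intro t ht
            rw [Finset.mem_Ico] at ht
            rw [ih t (by omega)]
            congr 1
            rw [Nat.div_eq_iff hr]
            have : (M + 1) * r = r * M + r := by ring
            omega
      · rw [Finset.disjoint_left]
        intro t h1 h2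
        simp only [Finset.mem_Ioo, Finset.mem_Ico] at h1 h2
        omega
    rw [hsum] at h
    rw [Nat.add_div_right _ hr]
    have hc : cc r (M + 1) = cc r M * (1 - 1 / ((r : ℝ) * (M + 1))) := by
      unfold cc; rw [Finset.prod_range_succ]
    have hr' : (0:ℝ) < r := by exact_mod_cast hr
    have hmr : (m : ℝ) = r * M + b := by exact_mod_cast hm
    have hn' : ((m + r : ℕ) : ℝ) ≠ 0 := by positivity
    apply mul_left_cancel₀ hn'
    rw [h]
    change _ = _ * cc r (M + 1)
    rw [hc]
    push_cast
    rw [hmr]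
    have : (M:ℝ) + 1 ≠ 0 := by positivity
    field_simp
    ring

lemma cc_lower (r : ℕ) (hr : 2 ≤ r) (M : ℕ) (hM : 1 ≤ M) :
    (1 / 2 : ℝ) * (M : ℝ) ^ (-(1 / (r : ℝ))) ≤ cc r M := by
  have hr' : (2:ℝ) ≤ r := by exact_mod_cast hr
  have hx : 1 / (r : ℝ) ≤ 1 / 2 := one_div_le_one_div_of_le (by norm_num) hr'
  have hx0 : 0 ≤ 1 / (r : ℝ) := by positivity
  induction M, hM using Nat.le_induction with
  | base => simp [cc] at hx ⊢; linarith
  | succ M hM ih =>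
    have hc : cc r (M + 1) = cc r M * (1 - 1 / ((r : ℝ) * (M + 1))) := by
      unfold cc; rw [Finset.prod_range_succ]
    have hM' : (1:ℝ) ≤ M := by exact_mod_cast hM
    have hb := rpow_one_add_le_one_add_mul_self (s := -(1 / ((M:ℝ) + 1))) (p := 1 / (r:ℝ))
      (by
        have : 1 / ((M:ℝ) + 1) ≤ 1 := by rw [div_le_one (by positivity)]; linarith
        linarith) hx0 (by linarith)
    have e1 : 1 + -(1 / ((M:ℝ) + 1)) = M / (M + 1) := by field_simp; ring
    have e2 : 1 + 1 / (r:ℝ) * -(1 / ((M:ℝ) + 1)) = 1 - 1 / ((r : ℝ) * (M + 1)) := by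
      field_simp; ring
    rw [e1, e2, Real.div_rpow (by positivity) (by positivity)] at hb
    rw [hc]
    refine le_trans ?_ (mul_le_mul ih hb (by positivity) (le_trans (by positivity) ih))
    rw [Real.rpow_neg (by positivity), Real.rpow_neg (by positivity)]
    push_cast
    have : (0:ℝ) < (M:ℝ) ^ (1 / (r:ℝ)) := by positivity
    have : (0:ℝ) < ((M:ℝ) + 1) ^ (1 / (r:ℝ)) := by positivity
    apply le_of_eq
    field_simp

lemma qq_lower (r : ℕ) (hr : 2 ≤ r) (n m : ℕ) (hn : 1 ≤ n) (hm : m ≤ n) :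
    1 / (4 * (n : ℝ) ^ (1 / (r : ℝ))) < qq r m := by
  have hn' : (1:ℝ) ≤ n := by exact_mod_cast hn
  have hp : (1:ℝ) ≤ (n:ℝ) ^ (1 / (r:ℝ)) := Real.one_le_rpow hn' (by positivity)
  rw [qq_eq r (by omega)]
  rcases Nat.eq_zero_or_pos (m / r) with h | h
  · rw [h]
    simp only [cc, Finset.range_zero, Finset.prod_empty]
    rw [div_lt_one (by positivity)]
    linarith
  · refine lt_of_lt_of_le ?_ (cc_lower r hr _ h)
    have hM : (0:ℝ) < ((m / r : ℕ) : ℝ) := by exact_mod_cast h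
    have hle : ((m / r : ℕ) : ℝ) ≤ n := by exact_mod_cast (Nat.div_le_self m r).trans hm
    have h1 : ((m / r : ℕ) : ℝ) ^ (1 / (r:ℝ)) ≤ (n:ℝ) ^ (1 / (r:ℝ)) :=
      Real.rpow_le_rpow hM.le hle (by positivity)
    rw [Real.rpow_neg hM.le]
    have h2 : (0:ℝ) < ((m / r : ℕ) : ℝ) ^ (1 / (r:ℝ)) := by positivity
    rw [div_mul_eq_mul_div, one_mul, inv_eq_one_div, div_div]
    apply one_div_lt_one_div_of_lt (by positivity)
    linarith

lemma half_dvd {a c o : ℕ} (hc : ¬ 2 ^ a ∣ c) (ho : 2 ^ a ∣ o) (hco : c ∣ o) :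
    c ∣ o / 2 := by
  have hc0 : c ≠ 0 := by rintro rfl; simp at hc
  obtain ⟨b, d, hd, rfl⟩ := Nat.exists_eq_two_pow_mul_odd hc0
  have hba : b < a := by
    by_contra h
    push Not at h
    exact hc (Dvd.dvd.mul_right (pow_dvd_pow 2 h) d)
  have hdo : d ∣ o := (Dvd.intro_left _ rfl).trans hco
  have hcop : Nat.Coprime (2 ^ a) d := Nat.Coprime.pow_left _ (Nat.coprime_two_left.mpr hd)
  have h1 : 2 ^ a * d ∣ o := hcop.mul_dvd_of_dvd_of_dvd ho hdo
  have h2 : 2 * (2 ^ b * d) ∣ o := by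
    refine Dvd.dvd.trans ?_ h1
    rw [← mul_assoc, ← pow_succ']
    exact mul_dvd_mul_right (pow_dvd_pow 2 hba) d
  obtain ⟨e, rfl⟩ := h2
  rw [mul_assoc, Nat.mul_div_cancel_left _ (by norm_num)]
  exact Dvd.intro _ rfl

lemma perm_good {n : ℕ} (g : Equiv.Perm (Fin n)) (a l : ℕ) (m : Multiset ℕ) (ha : 1 ≤ a)
    (hct : g.cycleType = l ::ₘ m) (hl : 2 ^ a ∣ l) (hm : ∀ i ∈ m, ¬ 2 ^ a ∣ i) :
    Even (orderOf g) ∧ orderOf (g ^ (orderOf g / 2)) = 2 ∧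
      (g ^ (orderOf g / 2)).support.card ≤ l := by
  have hlo : l ∣ orderOf g :=
    Equiv.Perm.dvd_of_mem_cycleType (by rw [hct]; exact Multiset.mem_cons_self _ _)
  have ho : 2 ^ a ∣ orderOf g := hl.trans hlo
  have h2 : 2 ∣ orderOf g := (dvd_pow_self 2 (by omega)).trans ho
  have hpos : 0 < orderOf g := orderOf_pos g
  refine ⟨even_iff_two_dvd.mpr h2, ?_, ?_⟩
  · obtain ⟨e, he⟩ := h2
    rw [orderOf_pow, he, Nat.mul_div_cancel_left _ (by norm_num)]
    rw [Nat.gcd_mul_left_left, Nat.mul_div_cancel _ (by omega)]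
  · have hmem : l ∈ g.cycleType := by rw [hct]; exact Multiset.mem_cons_self _ _
    obtain ⟨c, τ, hg, hd, hc, hcl⟩ := Equiv.Perm.mem_cycleType_iff.mp hmem
    have hτ : τ.cycleType = m := by
      have := hd.cycleType_mul
      rw [← hg, hct, hc.cycleType, hcl, Multiset.singleton_add] at this
      exact ((Multiset.cons_inj_right l).mp this).symm
    have hτo : τ ^ (orderOf g / 2) = 1 := by
      rw [← orderOf_dvd_iff_pow_eq_one, ← Equiv.Perm.lcm_cycleType, hτ, Multiset.lcm_dvd]
      intro i hi
      exact half_dvd (hm i hi) ho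
        (Equiv.Perm.dvd_of_mem_cycleType (by rw [hct]; exact Multiset.mem_cons_of_mem hi))
    have : g ^ (orderOf g / 2) = c ^ (orderOf g / 2) := by
      conv_lhs => rw [hg, hd.commute.mul_pow, ← hg, hτo, mul_one]
    rw [this, ← hcl]
    exact Finset.card_le_card (Equiv.Perm.support_pow_le c _)

lemma count_perm (n : ℕ) (m : Multiset ℕ) (hs : m.sum = n) (hp : ∀ i ∈ m, 0 < i) :
    (((Finset.univ.filter fun g : Equiv.Perm (Fin n) =>
      g.cycleType = m.filter (2 ≤ ·)).card : ℕ) : ℝ) = n.factorial * (1 / (zz m : ℝ)) := by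
  classical
  have hsplit : m = m.filter (2 ≤ ·) + Multiset.replicate (m.count 1) 1 := by
    conv_lhs => rw [← Multiset.filter_add_not (2 ≤ ·) m]
    congr 1
    rw [← Multiset.filter_eq']
    apply Multiset.filter_congr
    intro i hi
    have := hp i hi
    omega
  have hsum : (m.filter (2 ≤ ·)).sum + m.count 1 = n := by
    have := congrArg Multiset.sum hsplit
    rw [Multiset.sum_add, Multiset.sum_replicate, hs] at this
    simpa using this.symm
  have hprod : m.prod = (m.filter (2 ≤ ·)).prod := by
    have := congrArg Multiset.prod hsplit
    rw [Multiset.prod_add, Multiset.prod_replicate] at this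
    simpa using this
  have hz : zz m = (n - (m.filter (2 ≤ ·)).sum).factorial * (m.filter (2 ≤ ·)).prod *
      ∏ i ∈ (m.filter (2 ≤ ·)).toFinset, ((m.filter (2 ≤ ·)).count i).factorial := by
    have h1 : n - (m.filter (2 ≤ ·)).sum = m.count 1 := by omega
    rw [h1, zz_eq m (insert 1 (m.filter (2 ≤ ·)).toFinset), hprod, Finset.prod_insert (by simp)]
    · have : ∏ i ∈ (m.filter (2 ≤ ·)).toFinset, (m.count i).factorial =
        ∏ i ∈ (m.filter (2 ≤ ·)).toFinset, ((m.filter (2 ≤ ·)).count i).factorial := by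
        apply Finset.prod_congr rfl
        intro i hi
        rw [Multiset.mem_toFinset, Multiset.mem_filter] at hi
        rw [Multiset.count_filter_of_pos hi.2]
      rw [this]; ring
    · intro i hi
      rw [Multiset.mem_toFinset] at hi
      rw [Finset.mem_insert, Multiset.mem_toFinset, Multiset.mem_filter]
      have := hp i hi
      by_cases h : i = 1
      · exact Or.inl h
      · exact Or.inr ⟨hi, by omega⟩
  have key := Equiv.Perm.card_of_cycleType_mul_eq (α := Fin n) (m.filter (2 ≤ ·))
  rw [Fintype.card_fin, ← hz, if_pos ⟨by omega, fun i hi => (Multiset.mem_filter.mp hi).2⟩] at key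
  have hzp : (0:ℝ) < zz m := by exact_mod_cast zz_pos m hp
  rw [mul_one_div, eq_div_iff hzp.ne']
  exact_mod_cast key

lemma filter_inj (m m' : Multiset ℕ) (hs : m.sum = m'.sum) (hp : ∀ i ∈ m, 0 < i)
    (hp' : ∀ i ∈ m', 0 < i) (h : m.filter (2 ≤ ·) = m'.filter (2 ≤ ·)) : m = m' := by
  classical
  have aux : ∀ m : Multiset ℕ, (∀ i ∈ m, 0 < i) →
      m = m.filter (2 ≤ ·) + Multiset.replicate (m.count 1) 1 := by
    intro m hp
    conv_lhs => rw [← Multiset.filter_add_not (2 ≤ ·) m]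
    congr 1
    rw [← Multiset.filter_eq']
    apply Multiset.filter_congr
    intro i hi
    have := hp i hi
    omega
  have e1 := aux m hp
  have e2 := aux m' hp'
  have s1 := congrArg Multiset.sum e1
  have s2 := congrArg Multiset.sum e2
  rw [Multiset.sum_add, Multiset.sum_replicate] at s1 s2
  rw [h] at s1
  have : m.count 1 = m'.count 1 := by
    simp only [smul_eq_mul, mul_one] at s1 s2
    omega
  rw [e1, e2, h, this]

lemma count_lower (n s : ℕ) (hsn : s ≤ n) (T : Finset (ℕ × ℕ))
    (hT : ∀ x ∈ T, 1 ≤ x.1 ∧ Odd x.2 ∧ 2 ^ x.1 * x.2 ≤ s) :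
    (n.factorial : ℝ) * ∑ x ∈ T, qq (2 ^ x.1) (n - 2 ^ x.1 * x.2) / (2 ^ x.1 * x.2 : ℝ) ≤
      ((Finset.univ.filter fun g : Equiv.Perm (Fin n) => Even (orderOf g) ∧
        orderOf (g ^ (orderOf g / 2)) = 2 ∧
        (g ^ (orderOf g / 2)).support.card ≤ s).card : ℝ) := by
  classical
  let U : Finset (Σ _ : ℕ × ℕ, Multiset ℕ) :=
    T.sigma (fun x => SS (2 ^ x.1) (n - 2 ^ x.1 * x.2))
  let P : (Σ _ : ℕ × ℕ, Multiset ℕ) → Multiset ℕ := fun y => (2 ^ y.1.1 * y.1.2) ::ₘ y.2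
  let F : (Σ _ : ℕ × ℕ, Multiset ℕ) → Finset (Equiv.Perm (Fin n)) := fun y =>
    Finset.univ.filter fun g : Equiv.Perm (Fin n) => g.cycleType = (P y).filter (2 ≤ ·)
  have hU : ∀ y ∈ U, 1 ≤ y.1.1 ∧ Odd y.1.2 ∧ 2 ^ y.1.1 * y.1.2 ≤ s ∧ 2 ≤ 2 ^ y.1.1 * y.1.2 ∧
      (∀ i ∈ y.2, 0 < i) ∧ (∀ i ∈ y.2, ¬ 2 ^ y.1.1 ∣ i) ∧ (P y).sum = n ∧
      (∀ i ∈ P y, 0 < i) := by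
    intro y hy
    obtain ⟨h1, h2⟩ := Finset.mem_sigma.mp hy
    obtain ⟨h3, h4, h5⟩ := hT _ h1
    obtain ⟨h6, h7, h8⟩ := mem_SS.mp h2
    have h2l : 2 ≤ 2 ^ y.1.1 * y.1.2 := by
      have := Nat.pow_le_pow_right (n := 2) (by norm_num) h3
      have := h4.pos
      nlinarith
    refine ⟨h3, h4, h5, h2l, h7, h8, ?_, ?_⟩
    · simp only [P, Multiset.sum_cons, h6]
      omega
    · intro i hi
      rcases Multiset.mem_cons.mp hi with rfl | hi
      · omega
      · exact h7 i hi
  have hlhs : (n.factorial : ℝ) * ∑ x ∈ T, qq (2 ^ x.1) (n - 2 ^ x.1 * x.2) / (2 ^ x.1 * x.2 : ℝ)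
      = ∑ y ∈ U, ((F y).card : ℝ) := by
    have : ∀ x ∈ T, qq (2 ^ x.1) (n - 2 ^ x.1 * x.2) / (2 ^ x.1 * x.2 : ℝ) =
        ∑ m ∈ SS (2 ^ x.1) (n - 2 ^ x.1 * x.2), 1 / (zz (P ⟨x, m⟩) : ℝ) := by
      intro x hx
      rw [qq, Finset.sum_div]
      apply Finset.sum_congr rfl
      intro m hm
      have hc : m.count (2 ^ x.1 * x.2) = 0 := Multiset.count_eq_zero_of_notMem fun h =>
        (mem_SS.mp hm).2.2 _ h (Dvd.intro _ rfl)
      simp only [P]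
      rw [zz_cons, hc]
      push_cast
      rw [div_div]
      congr 1
      ring
    rw [Finset.sum_congr rfl this, Finset.mul_sum]
    simp only [U]
    rw [Finset.sum_sigma]
    apply Finset.sum_congr rfl
    intro x hx
    rw [Finset.mul_sum]
    apply Finset.sum_congr rfl
    intro m hm
    have := hU ⟨x, m⟩ (Finset.mem_sigma.mpr ⟨hx, hm⟩)
    rw [← count_perm n (P ⟨x, m⟩) this.2.2.2.2.2.2.1 this.2.2.2.2.2.2.2]
  rw [hlhs, ← Nat.cast_sum, Nat.cast_le, ← Finset.card_biUnion]
  · apply Finset.card_le_card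
    intro g hg
    rw [Finset.mem_biUnion] at hg
    obtain ⟨y, hy, hgy⟩ := hg
    obtain ⟨h1, h2, h3, h4, h5, h6, h7, h8⟩ := hU y hy
    have hct : g.cycleType = (P y).filter (2 ≤ ·) := (Finset.mem_filter.mp hgy).2
    simp only [P] at hct
    rw [Multiset.filter_cons_of_pos _ h4] at hct
    have := perm_good g y.1.1 _ _ h1 hct (Dvd.intro _ rfl)
      (fun i hi => h6 i (Multiset.mem_filter.mp hi).1)
    rw [Finset.mem_filter]
    exact ⟨Finset.mem_univ _, this.1, this.2.1, this.2.2.trans h3⟩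
  · intro y hy y' hy' hne
    rw [Function.onFun, Finset.disjoint_left]
    intro g hg hg'
    apply hne
    have hct : g.cycleType = (P y).filter (2 ≤ ·) := (Finset.mem_filter.mp hg).2
    have hct' : g.cycleType = (P y').filter (2 ≤ ·) := (Finset.mem_filter.mp hg').2
    have aux : ∀ y ∈ U, ∀ y' ∈ U, P y = P y' → ¬ y.1.1 < y'.1.1 := by
      intro y hy y' hy' he hlt
      obtain ⟨h1, h2, h3, h4, h5, h6, h7, h8⟩ := hU y hy
      have hmem : 2 ^ y'.1.1 * y'.1.2 ∈ P y := by rw [he]; exact Multiset.mem_cons_self _ _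
      rcases Multiset.mem_cons.mp hmem with h | h
      · have : 2 ^ (y.1.1 + 1) ∣ 2 ^ y.1.1 * y.1.2 := by
          rw [← h]; exact Dvd.dvd.mul_right (pow_dvd_pow 2 hlt) _
        rw [pow_succ, Nat.mul_dvd_mul_iff_left (by positivity)] at this
        exact (Nat.not_even_iff_odd.mpr h2) (even_iff_two_dvd.mpr this)
      · exact h6 _ h (Dvd.dvd.mul_right (pow_dvd_pow 2 hlt.le) _)
    obtain ⟨h1, h2, h3, h4, h5, h6, h7, h8⟩ := hU y hy
    obtain ⟨h1', h2', h3', h4', h5', h6', h7', h8'⟩ := hU y' hy'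
    have he : P y = P y' := filter_inj _ _ (by rw [h7, h7']) h8 h8' (hct.symm.trans hct')
    have ha : y.1.1 = y'.1.1 :=
      le_antisymm (not_lt.mp (aux y' hy' y hy he.symm)) (not_lt.mp (aux y hy y' hy' he))
    have hl : 2 ^ y'.1.1 * y'.1.2 = 2 ^ y.1.1 * y.1.2 := by
      have hmem : 2 ^ y'.1.1 * y'.1.2 ∈ P y := by rw [he]; exact Multiset.mem_cons_self _ _
      rcases Multiset.mem_cons.mp hmem with h | h
      · exact h
      · exact absurd (by rw [ha]; exact Dvd.intro _ rfl) (h6 _ h)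
    have hk : y.1.2 = y'.1.2 := by
      rw [ha] at hl
      exact (Nat.eq_of_mul_eq_mul_left (by positivity) hl).symm
    have hm : y.2 = y'.2 := by
      simp only [P] at he
      rw [hl] at he
      exact (Multiset.cons_inj_right _).mp he
    obtain ⟨⟨a, k⟩, m⟩ := y
    obtain ⟨⟨a', k'⟩, m'⟩ := y'
    simp only at ha hk hm
    subst ha hk hm
    rfl

theorem stmt7 (ε : ℝ) (hε : ε ∈ Set.Ioo (0 : ℝ) 1) (n : ℕ)
    (h1 : ⌈(Real.log n + 1) ^ 2⌉ < ⌈(n : ℝ) ^ ε⌉)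
    (h2 : ⌈(n : ℝ) ^ ε⌉ ≤ (n : ℤ) - 2 * ⌈Real.log n⌉)
    (K : ℕ) (hK : (K : ℤ) = ⌈(n : ℝ) ^ ε⌉ / ⌈Real.log n⌉) :
    symPropn n ε >
      (1 / 4) * (∑ k ∈ (Finset.Icc 1 K).filter (fun k => Odd k), (1 : ℝ) / k) *
        (∑ a ∈ Finset.Icc 1 (Nat.log 2 ⌈Real.log n⌉.toNat),
          1 / ((2 : ℝ) ^ a * (n : ℝ) ^ (1 / (2 : ℝ) ^ a))) := by
  classical
  have hlog0 : 0 ≤ Real.log n := Real.log_natCast_nonneg n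
  obtain ⟨L, hL⟩ : ∃ L : ℕ, ⌈Real.log n⌉ = L :=
    ⟨⌈Real.log n⌉.toNat, (Int.toNat_of_nonneg (Int.ceil_nonneg hlog0)).symm⟩
  obtain ⟨s, hs⟩ : ∃ s : ℕ, ⌈(n : ℝ) ^ ε⌉ = s :=
    ⟨⌈(n : ℝ) ^ ε⌉.toNat, (Int.toNat_of_nonneg (Int.ceil_nonneg (by positivity))).symm⟩
  rw [hL, hs] at hK
  rw [hs, hL] at h2
  rw [hs] at h1
  have hs1 : (Real.log n + 1) ^ 2 < s := by
    have : (⌈(Real.log n + 1) ^ 2⌉ : ℝ) < ((s : ℤ) : ℝ) := by exact_mod_cast h1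
    exact lt_of_le_of_lt (Int.le_ceil _) (by simpa using this)
  have hLlt : (L : ℝ) < Real.log n + 1 := by
    have := Int.ceil_lt_add_one (Real.log n)
    rw [hL] at this
    simpa using this
  have hLs : L * L < s := by
    have h0 : (0:ℝ) ≤ L := by positivity
    have : (L : ℝ) * L < s := by nlinarith
    exact_mod_cast this
  have hs2 : 1 < s := by
    have : (1:ℝ) < s := by nlinarith
    exact_mod_cast this
  have hn3 : 2 ≤ n := by omega
  have hL2 : 2 ≤ L := by
    by_contra hlt
    have hn : n ≤ 2 := by
      have : Real.log n ≤ L := by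
        have := Int.le_ceil (Real.log n); rw [hL] at this; simpa using this
      have hL1 : (L : ℝ) ≤ 1 := by exact_mod_cast (by omega : L ≤ 1)
      have h3 : (n : ℝ) ≤ Real.exp 1 := by
        rw [← Real.log_le_iff_le_exp (by positivity)]; linarith
      have := Real.exp_one_lt_d9
      have : (n : ℝ) < 3 := by linarith
      have : n < 3 := by exact_mod_cast this
      omega
    have hn2 : n = 2 := by omega
    subst hn2
    have : 0 < ⌈Real.log (2:ℕ)⌉ := Int.ceil_pos.mpr (Real.log_pos (by norm_num))
    rw [hL] at this
    omega
  have hKe : K = s / L := by exact_mod_cast hK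
  have hK1 : 1 ≤ K := by
    rw [hKe, Nat.le_div_iff_mul_le (by omega)]; nlinarith
  have hKL : K * L ≤ s := by rw [hKe]; exact Nat.div_mul_le_self s L
  set A := Finset.Icc 1 (Nat.log 2 L) with hA
  set O := (Finset.Icc 1 K).filter (fun k => Odd k) with hO
  have hAL : ⌈Real.log n⌉.toNat = L := by rw [hL]; simp
  rw [hAL]
  have hT : ∀ x ∈ A ×ˢ O, 1 ≤ x.1 ∧ Odd x.2 ∧ 2 ^ x.1 * x.2 ≤ s := by
    intro x hx
    simp only [hA, hO, Finset.mem_product, Finset.mem_filter, Finset.mem_Icc] at hx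
    obtain ⟨⟨a1, a2⟩, ⟨k1, k2⟩, k3⟩ := hx
    refine ⟨a1, k3, ?_⟩
    have : 2 ^ x.1 ≤ L := Nat.pow_le_of_le_log (by omega) a2
    calc 2 ^ x.1 * x.2 ≤ L * K := Nat.mul_le_mul this k2
      _ ≤ s := by rw [mul_comm]; exact hKL
  have hcount := count_lower n s (by omega) (A ×ˢ O) hT
  have hp : symPropn n ε = ((Finset.univ.filter fun g : Equiv.Perm (Fin n) => Even (orderOf g) ∧
        orderOf (g ^ (orderOf g / 2)) = 2 ∧
        (g ^ (orderOf g / 2)).support.card ≤ s).card : ℝ) / n.factorial := by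
    unfold symPropn
    rw [hs, Nat.card_eq_fintype_card, Fintype.card_subtype, Nat.card_eq_fintype_card,
      Fintype.card_perm, Fintype.card_fin]
    simp only [Nat.cast_le]
  have hfac : (0:ℝ) < n.factorial := by exact_mod_cast n.factorial_pos
  rw [hp]
  have hstep : ∑ x ∈ A ×ˢ O, qq (2 ^ x.1) (n - 2 ^ x.1 * x.2) / (2 ^ x.1 * x.2 : ℝ) ≤
      ((Finset.univ.filter fun g : Equiv.Perm (Fin n) => Even (orderOf g) ∧
        orderOf (g ^ (orderOf g / 2)) = 2 ∧
        (g ^ (orderOf g / 2)).support.card ≤ s).card : ℝ) / n.factorial := by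
    rw [le_div_iff₀ hfac, mul_comm]; exact hcount
  refine lt_of_lt_of_le ?_ hstep
  have hrhs : (1 / 4) * (∑ k ∈ O, (1 : ℝ) / k) *
        (∑ a ∈ A, 1 / ((2 : ℝ) ^ a * (n : ℝ) ^ (1 / (2 : ℝ) ^ a))) =
      ∑ x ∈ A ×ˢ O, (1 / (4 * (n : ℝ) ^ (1 / (2 : ℝ) ^ x.1))) / (2 ^ x.1 * x.2 : ℝ) := by
    rw [mul_assoc, mul_comm (∑ k ∈ O, (1 : ℝ) / k), Finset.sum_mul_sum, Finset.sum_product,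
      Finset.mul_sum]
    apply Finset.sum_congr rfl
    intro a _
    rw [Finset.mul_sum]
    apply Finset.sum_congr rfl
    intro k _
    simp only [one_div, mul_inv, div_eq_mul_inv, one_mul]
    ring
  rw [hrhs]
  apply Finset.sum_lt_sum_of_nonempty
  · refine ⟨(1, 1), ?_⟩
    simp only [hA, hO, Finset.mem_product, Finset.mem_filter, Finset.mem_Icc]
    exact ⟨⟨le_refl _, Nat.log_pos (by norm_num) hL2⟩, ⟨le_refl _, hK1⟩, odd_one⟩
  · intro x hx
    obtain ⟨h3, h4, h5⟩ := hT x hx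
    have hk : (0:ℝ) < x.2 := by exact_mod_cast h4.pos
    have h2x : 2 ≤ 2 ^ x.1 := by
      simpa using Nat.pow_le_pow_right (n := 2) (by norm_num) h3
    have := qq_lower (2 ^ x.1) h2x n (n - 2 ^ x.1 * x.2) (by omega) (Nat.sub_le _ _)
    push_cast at this
    exact div_lt_div_of_pos_right this (by positivity)
end

section
/- Let ε ∈ (0,1) and let n be an integer satisfying ⌈(log(n)+1)²⌉ < ⌈n^ε⌉ ≤ n − 2⌈log(n)⌉. Then p(n,ε) > (ε/(16·log(2))) · (1/e − 1/n). -/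
open Classical in
/-- Permutations without cycles (fixed points included) of length divisible by `b`. -/
noncomputable def bfree (b : ℕ) (α : Type) [Fintype α] : Finset (Equiv.Perm α) :=
  Finset.univ.filter fun g => ∀ x, ¬ b ∣ Function.minimalPeriod g x

open Classical in
/-- Transitive cyclic permutations. -/
noncomputable def cycs (α : Type) [Fintype α] : Finset (Equiv.Perm α) :=
  Finset.univ.filter fun g => g.IsCycleOn ((Finset.univ : Finset α) : Set α)

open Classical in
/-- Permutations cyclic on `T` and with no cycle of length divisible by `b` off `T`. -/
noncomputable def glued (b : ℕ) {α : Type} [Fintype α] (T : Finset α) :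
    Finset (Equiv.Perm α) :=
  (cycs {x // x ∈ T} ×ˢ bfree b {x // ¬ x ∈ T}).image
    fun p => Equiv.Perm.subtypeCongr p.1 p.2

lemma card_cycs (α : Type) [Fintype α] [Nonempty α] :
    (Fintype.card α - 1).factorial ≤ (cycs α).card := by
  classical
  rcases Nat.lt_or_ge (Fintype.card α) 2 with h | h
  · have h1 : Fintype.card α = 1 := by
      have := Fintype.card_pos (α := α); omega
    rw [h1]
    simp only [Nat.sub_self, Nat.factorial_zero]
    rw [Nat.succ_le_iff, Finset.card_pos]
    have : Subsingleton α := Fintype.card_le_one_iff_subsingleton.mp h1.le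
    refine ⟨1, ?_⟩
    simp only [cycs, Finset.mem_filter, Finset.mem_univ, true_and]
    refine ⟨?_, ?_⟩
    · simp
    · intro x _ y _
      rw [Subsingleton.elim x y]
  · have := Equiv.Perm.card_of_cycleType_singleton (α := α) h le_rfl
    rw [Nat.choose_self, mul_one] at this
    rw [← this]
    apply Finset.card_le_card
    intro g hg
    simp only [Finset.mem_filter, Finset.mem_univ, true_and] at hg
    simp only [cycs, Finset.mem_filter, Finset.mem_univ, true_and]
    have hc : g.IsCycle := by
      rw [← Equiv.Perm.card_cycleType_eq_one, hg]; simp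
    have hs : g.support = Finset.univ := by
      rw [← Finset.card_eq_iff_eq_univ, ← Equiv.Perm.sum_cycleType, hg]; simp
    have := hc.isCycleOn
    convert this
    ext x
    have : x ∈ g.support := by simp [hs]
    simpa using this

lemma glued_pow_left {α : Type} [Fintype α] [DecidableEq α] (T : Finset α)
    (c : Equiv.Perm {x // x ∈ T}) (h : Equiv.Perm {x // ¬ x ∈ T}) (x : {x // x ∈ T}) (i : ℕ) :
    ((Equiv.Perm.subtypeCongr c h) ^ i) (x : α) = ((c ^ i) x : {x // x ∈ T}) := by
  induction i with
  | zero => simp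
  | succ i ih =>
    rw [pow_succ', pow_succ', Equiv.Perm.mul_apply, ih, Equiv.Perm.mul_apply,
      Equiv.Perm.subtypeCongr.left_apply_subtype]

lemma glued_pow_right {α : Type} [Fintype α] [DecidableEq α] (T : Finset α)
    (c : Equiv.Perm {x // x ∈ T}) (h : Equiv.Perm {x // ¬ x ∈ T}) (x : {x // ¬ x ∈ T}) (i : ℕ) :
    ((Equiv.Perm.subtypeCongr c h) ^ i) (x : α) = ((h ^ i) x : {x // ¬ x ∈ T}) := by
  induction i with
  | zero => simp
  | succ i ih =>
    rw [pow_succ', pow_succ', Equiv.Perm.mul_apply, ih, Equiv.Perm.mul_apply,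
      Equiv.Perm.subtypeCongr.right_apply_subtype]

lemma mem_glued {b : ℕ} {α : Type} [Fintype α] {T : Finset α} {g : Equiv.Perm α}
    (hg : g ∈ glued b T) :
    (∀ x ∈ T, Function.minimalPeriod g x = T.card) ∧
    (∀ x, x ∉ T → ¬ b ∣ Function.minimalPeriod g x) ∧
    (∀ x ∈ T, ∀ y, y ∈ T ↔ ∃ i : ℕ, (g ^ i) x = y) := by
  classical
  simp only [glued, Finset.mem_image, Finset.mem_product, cycs, bfree, Finset.mem_filter,
    Finset.mem_univ, true_and] at hg
  obtain ⟨⟨c, h⟩, ⟨hc, hh⟩, hgl⟩ := hg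
  simp only at hc hh hgl
  have hL : ∀ (x : {x // x ∈ T}) (i : ℕ), (g ^ i) (x : α) = ((c ^ i) x : {x // x ∈ T}) := by
    intro x i
    rw [← glued_pow_left T c h x i, ← hgl]
  have hR : ∀ (x : {x // ¬ x ∈ T}) (i : ℕ), (g ^ i) (x : α) = ((h ^ i) x : {x // ¬ x ∈ T}) := by
    intro x i
    rw [← glued_pow_right T c h x i, ← hgl]
  refine ⟨?_, ?_, ?_⟩
  · intro x hx
    apply Nat.dvd_antisymm
    · apply Function.IsPeriodicPt.minimalPeriod_dvd
      rw [Function.IsPeriodicPt, Function.IsFixedPt, Equiv.Perm.iterate_eq_pow]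
      rw [hL ⟨x, hx⟩, (hc.pow_apply_eq (Finset.mem_univ _)).2]
      simp
    · have h1 := Function.isPeriodicPt_minimalPeriod g x
      rw [Function.IsPeriodicPt, Function.IsFixedPt, Equiv.Perm.iterate_eq_pow,
        hL ⟨x, hx⟩] at h1
      have h2 := (hc.pow_apply_eq (a := ⟨x, hx⟩) (Finset.mem_univ _)).1 (Subtype.ext h1)
      simpa using h2
  · intro x hx
    have : Function.minimalPeriod g x = Function.minimalPeriod h ⟨x, hx⟩ := by
      rw [Function.minimalPeriod_eq_minimalPeriod_iff]
      intro i
      simp only [Function.IsPeriodicPt, Function.IsFixedPt, Equiv.Perm.iterate_eq_pow]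
      rw [hR ⟨x, hx⟩, Subtype.ext_iff]
    rw [this]
    exact hh _
  · intro x hx y
    constructor
    · intro hy
      obtain ⟨i, -, hi⟩ := hc.exists_pow_eq (Finset.mem_univ (⟨x, hx⟩ : {x // x ∈ T}))
        (Finset.mem_univ (⟨y, hy⟩ : {x // x ∈ T}))
      exact ⟨i, by rw [hL ⟨x, hx⟩, hi]⟩
    · rintro ⟨i, rfl⟩
      rw [hL ⟨x, hx⟩]
      exact Subtype.property _

lemma card_glued (b : ℕ) {α : Type} [Fintype α] {T : Finset α} (hT : T.Nonempty)
    (I : Fintype {x // ¬ x ∈ T}) :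
    (T.card - 1).factorial * (bfree b {x // ¬ x ∈ T}).card ≤ (glued b T).card := by
  classical
  rw [glued, Finset.card_image_of_injective, Finset.card_product]
  · have h2 : ∀ J : Fintype {x // ¬ x ∈ T},
        (@bfree b {x // ¬ x ∈ T} J).card = (@bfree b {x // ¬ x ∈ T} I).card := by
      intro J
      rw [Subsingleton.elim J I]
    have h3 : ∀ J : Fintype {x // x ∈ T},
        (T.card - 1).factorial ≤ (@cycs {x // x ∈ T} J).card := by
      intro J
      have h4 := @card_cycs {x // x ∈ T} J hT.to_subtype
      rwa [Fintype.card_coe] at h4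
    exact Nat.mul_le_mul (h3 _) (h2 _).ge
  · intro p q hpq
    exact Equiv.Perm.subtypeCongrHom_injective (fun x => x ∈ T) (by simpa using hpq)

/-- The product `∏_{i ≤ q} (1 - 1/(ib))`. -/
noncomputable def cprod (b q : ℕ) : ℝ := ∏ i ∈ Finset.range q, (1 - 1 / (((i : ℝ) + 1) * b))

lemma cprod_succ (b q : ℕ) : cprod b (q + 1) = cprod b q * (1 - 1 / (((q : ℝ) + 1) * b)) := by
  rw [cprod, Finset.prod_range_succ]; rfl

lemma cprod_nonneg (b q : ℕ) : 0 ≤ cprod b q := by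
  apply Finset.prod_nonneg
  intro i _
  rw [sub_nonneg]
  rcases Nat.eq_zero_or_pos b with rfl | hb
  · simp
  · rw [div_le_one (by positivity)]
    have : (1 : ℝ) ≤ b := by exact_mod_cast hb
    nlinarith [(Nat.cast_nonneg i : (0 : ℝ) ≤ i)]

lemma cprod_rec (b : ℕ) (hb : 0 < b) (q r : ℕ) (hr : r < b) :
    ∑ i ∈ Finset.range (q * b + r), (if b ∣ (q * b + r - i) then 0 else cprod b (i / b))
      = ((q * b + r : ℕ) : ℝ) * cprod b q := by
  have key : ∀ q : ℕ, ((b : ℝ) - 1) * ∑ i ∈ Finset.range q, cprod b i = q * b * cprod b q := by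
    intro q
    induction q with
    | zero => simp
    | succ q ih =>
      rw [Finset.sum_range_succ, mul_add, ih, cprod_succ]
      have : (b : ℝ) ≠ 0 := by positivity
      push_cast
      field_simp
      ring
  -- block sums
  have blk : ∀ q' : ℕ, q' < q → ∑ s ∈ Finset.range b,
      (if b ∣ (q * b + r - (q' * b + s)) then 0 else cprod b ((q' * b + s) / b))
        = ((b : ℝ) - 1) * cprod b q' := by
    intro q' hq'
    have : ∀ s ∈ Finset.range b,
        (if b ∣ (q * b + r - (q' * b + s)) then (0 : ℝ) else cprod b ((q' * b + s) / b))
          = cprod b q' - if s = r then cprod b q' else 0 := by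
      intro s hs
      rw [Finset.mem_range] at hs
      have h1 : (q' * b + s) / b = q' := by
        rw [mul_comm, Nat.mul_add_div hb, Nat.div_eq_of_lt hs, add_zero]
      have hle : q' * b + s ≤ q * b + r := by nlinarith
      have h2 : b ∣ (q * b + r - (q' * b + s)) ↔ s = r := by
        rw [← Nat.modEq_iff_dvd' hle]
        simp [Nat.ModEq, Nat.mod_eq_of_lt hs, Nat.mod_eq_of_lt hr]
      rw [h1]
      by_cases hsr : s = r
      · rw [if_pos (h2.2 hsr), if_pos hsr]; simp
      · rw [if_neg (fun h => hsr (h2.1 h)), if_neg hsr]; simp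
    rw [Finset.sum_congr rfl this, Finset.sum_sub_distrib, Finset.sum_ite_eq',
      if_pos (Finset.mem_range.2 hr)]
    simp
    ring
  have all : ∀ q' : ℕ, q' ≤ q → ∑ i ∈ Finset.range (q' * b),
      (if b ∣ (q * b + r - i) then 0 else cprod b (i / b))
        = ((b : ℝ) - 1) * ∑ i ∈ Finset.range q', cprod b i := by
    intro q' hq'
    induction q' with
    | zero => simp
    | succ q' ih =>
      rw [add_mul, one_mul, Finset.sum_range_add, ih (by omega), blk q' (by omega),
        Finset.sum_range_succ]
      ring
  rw [Finset.sum_range_add, all q le_rfl, key]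
  have : ∀ s ∈ Finset.range r,
      (if b ∣ (q * b + r - (q * b + s)) then (0 : ℝ) else cprod b ((q * b + s) / b))
        = cprod b q := by
    intro s hs
    rw [Finset.mem_range] at hs
    have h1 : (q * b + s) / b = q := by
      rw [mul_comm, Nat.mul_add_div hb, Nat.div_eq_of_lt (hs.trans hr), add_zero]
    rw [h1, if_neg]
    intro hd
    have := Nat.le_of_dvd (by omega) hd
    omega
  rw [Finset.sum_congr rfl this]
  simp
  ring

lemma cprod_rec' (b : ℕ) (hb : 0 < b) (N : ℕ) :
    ∑ i ∈ Finset.range N, (if b ∣ (N - i) then 0 else cprod b (i / b))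
      = (N : ℝ) * cprod b (N / b) := by
  have := cprod_rec b hb (N / b) (N % b) (Nat.mod_lt _ hb)
  rwa [mul_comm (N / b) b, Nat.div_add_mod] at this

lemma card_bfree (b : ℕ) (hb : 0 < b) (N : ℕ) : ∀ (α : Type) [Fintype α], Fintype.card α = N →
    (N.factorial : ℝ) * cprod b (N / b) ≤ (bfree b α).card := by
  induction N using Nat.strong_induction_on with
  | _ N ih =>
  intro α _ hα
  classical
  rcases Nat.eq_zero_or_pos N with rfl | hN
  · have : IsEmpty α := Fintype.card_eq_zero_iff.mp hα
    simp [bfree, cprod]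
  obtain ⟨x⟩ : Nonempty α := Fintype.card_pos_iff.mp (hα ▸ hN)
  -- index set
  set U : Finset (Finset α) := ((Finset.univ.erase x).powerset).filter
    (fun T => ¬ b ∣ T.card + 1) with hU
  have hxU : ∀ T ∈ U, x ∉ T := by
    intro T hT hx
    rw [hU, Finset.mem_filter, Finset.mem_powerset] at hT
    simpa using hT.1 hx
  have hdisj : (U : Set (Finset α)).PairwiseDisjoint (fun T => glued b (insert x T)) := by
    intro T hT T' hT' hne
    rw [Function.onFun, Finset.disjoint_left]
    intro g hg hg'
    apply hne
    have e : insert x T = insert x T' := by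
      ext y
      rw [(mem_glued hg).2.2 x (Finset.mem_insert_self _ _) y,
        (mem_glued hg').2.2 x (Finset.mem_insert_self _ _) y]
    rw [← Finset.erase_insert (hxU T hT), e, Finset.erase_insert (hxU T' hT')]
  have hsub : U.biUnion (fun T => glued b (insert x T)) ⊆ bfree b α := by
    intro g hg
    rw [Finset.mem_biUnion] at hg
    obtain ⟨T, hT, hg⟩ := hg
    simp only [bfree, Finset.mem_filter, Finset.mem_univ, true_and]
    intro y
    by_cases hy : y ∈ insert x T
    · rw [(mem_glued hg).1 y hy, Finset.card_insert_of_notMem (hxU T hT)]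
      exact (Finset.mem_filter.1 hT).2
    · exact (mem_glued hg).2.1 y hy
  have hcard := Finset.card_le_card hsub
  rw [Finset.card_biUnion hdisj] at hcard
  have hterm : ∀ T ∈ U, ((T.card.factorial : ℝ) * (((N - 1 - T.card).factorial : ℝ) *
      cprod b ((N - 1 - T.card) / b))) ≤ ((glued b (insert x T)).card : ℝ) := by
    intro T hT
    have h1 := card_glued b (T := insert x T) (Finset.insert_nonempty _ _) inferInstance
    rw [Finset.card_insert_of_notMem (hxU T hT), Nat.add_sub_cancel] at h1
    have hc : Fintype.card {y // ¬ y ∈ insert x T} = N - 1 - T.card := by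
      rw [Fintype.card_subtype_compl, Fintype.card_coe,
        Finset.card_insert_of_notMem (hxU T hT), hα]
      omega
    have h2 := ih (N - 1 - T.card) (by omega) {y // ¬ y ∈ insert x T} hc
    calc _ ≤ (T.card.factorial : ℝ) * ((bfree b {y // ¬ y ∈ insert x T}).card : ℝ) := by gcongr
      _ ≤ _ := by exact_mod_cast h1
  have hsum : ∑ T ∈ U, ((T.card.factorial : ℝ) * (((N - 1 - T.card).factorial : ℝ) *
      cprod b ((N - 1 - T.card) / b))) = (N.factorial : ℝ) * cprod b (N / b) := by
    rw [hU, Finset.sum_filter]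
    rw [Finset.sum_powerset_apply_card (fun k => if ¬ b ∣ k + 1 then
      ((k.factorial : ℝ) * (((N - 1 - k).factorial : ℝ) * cprod b ((N - 1 - k) / b))) else 0)]
    rw [Finset.card_erase_of_mem (Finset.mem_univ _), Finset.card_univ, hα,
      Nat.sub_add_cancel hN, ← Finset.sum_range_reflect]
    have : ∀ i ∈ Finset.range N, ((N - 1).choose (N - 1 - i) • if ¬ b ∣ N - 1 - i + 1 then
        (((N - 1 - i).factorial : ℝ) * (((N - 1 - (N - 1 - i)).factorial : ℝ) *
          cprod b ((N - 1 - (N - 1 - i)) / b))) else 0)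
        = ((N - 1).factorial : ℝ) * (if b ∣ (N - i) then 0 else cprod b (i / b)) := by
      intro i hi
      rw [Finset.mem_range] at hi
      have e1 : N - 1 - i + 1 = N - i := by omega
      have e2 : N - 1 - (N - 1 - i) = i := by omega
      have e3 := Nat.choose_mul_factorial_mul_factorial (n := N - 1) (k := N - 1 - i) (by omega)
      rw [e2] at e3
      rw [e1, e2, ← e3]
      by_cases hd : b ∣ N - i
      · simp [hd]
      · simp only [hd, not_false_eq_true, if_true, if_false, nsmul_eq_mul]
        push_cast
        ring
    rw [Finset.sum_congr rfl this, ← Finset.mul_sum, cprod_rec' b hb, ← mul_assoc]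
    congr 1
    obtain ⟨M, rfl⟩ : ∃ M, N = M + 1 := ⟨N - 1, by omega⟩
    rw [Nat.add_sub_cancel, Nat.factorial_succ]
    push_cast
    ring
  rw [← hsum]
  calc _ ≤ ∑ T ∈ U, ((glued b (insert x T)).card : ℝ) := Finset.sum_le_sum hterm
    _ ≤ _ := by exact_mod_cast hcard

lemma glued_order {a : ℕ} (ha : 1 ≤ a) {α : Type} [Fintype α] [DecidableEq α] {T : Finset α}
    (hT : T.Nonempty) (hd : 2 ^ a ∣ T.card) {g : Equiv.Perm α} (hg : g ∈ glued (2 ^ a) T) :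
    Even (orderOf g) ∧ orderOf (g ^ (orderOf g / 2)) = 2 ∧
      (g ^ (orderOf g / 2)).support = T := by
  obtain ⟨hin, hout, -⟩ := mem_glued hg
  have hper : ∀ (x : α) (i : ℕ), (g ^ i) x = x ↔ Function.minimalPeriod g x ∣ i := by
    intro x i
    rw [← Function.isPeriodicPt_iff_minimalPeriod_dvd, Function.IsPeriodicPt,
      Function.IsFixedPt, Equiv.Perm.iterate_eq_pow]
  have hmo : ∀ x, Function.minimalPeriod g x ∣ orderOf g := by
    intro x
    rw [← hper, pow_orderOf_eq_one]; rfl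
  obtain ⟨x0, hx0⟩ := hT
  have hb : 2 ^ a ∣ orderOf g := (hd.trans (hin x0 hx0 ▸ dvd_rfl)).trans (hmo x0)
  have h2 : 2 ∣ orderOf g := (dvd_pow_self 2 (by omega)).trans hb
  have ho : 0 < orderOf g := orderOf_pos g
  have hne : g ^ (orderOf g / 2) ≠ 1 := by
    intro h
    have := Nat.le_of_dvd (by omega) (orderOf_dvd_of_pow_eq_one h)
    omega
  have hfix : ∀ x, x ∉ T → (g ^ (orderOf g / 2)) x = x := by
    intro x hx
    rw [hper]
    obtain ⟨e, he⟩ := hmo x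
    rcases Nat.even_or_odd' e with ⟨f, rfl | rfl⟩
    · refine ⟨f, ?_⟩
      rw [he, mul_left_comm, Nat.mul_div_cancel_left _ (by norm_num)]
    · exfalso
      apply hout x hx
      rw [he] at hb
      refine Nat.Coprime.dvd_of_dvd_mul_right ?_ hb
      apply Nat.Coprime.pow_left
      simp
  refine ⟨even_iff_two_dvd.2 h2, ?_, ?_⟩
  · apply orderOf_eq_prime _ hne
    rw [← pow_mul, Nat.div_mul_cancel h2, pow_orderOf_eq_one]
  · ext x
    rw [Equiv.Perm.mem_support]
    constructor
    · intro h
      by_contra hx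
      exact h (hfix x hx)
    · intro hx h
      apply hne
      ext y
      rw [Equiv.Perm.one_apply]
      by_cases hy : y ∈ T
      · rw [hper, hin y hy, ← hin x hx, ← hper, h]
      · exact hfix y hy

lemma main_count (a : ℕ) (ha : 1 ≤ a) (n m : ℕ) (hmn : m ≤ n) (c0 : ℝ) (hc0 : 0 ≤ c0)
    (hc : ∀ q ≤ n, c0 ≤ cprod (2 ^ a) q) (B : Finset (Equiv.Perm (Fin n)))
    (hB : ∀ g : Equiv.Perm (Fin n), Even (orderOf g) → orderOf (g ^ (orderOf g / 2)) = 2 →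
      (g ^ (orderOf g / 2)).support.card ≤ m → g ∈ B) :
    (n.factorial : ℝ) * (c0 * (1 / (2 ^ a : ℕ) *
      ∑ i ∈ Finset.range (m / 2 ^ a), 1 / ((i : ℝ) + 1))) ≤ B.card := by
  classical
  have hb0 : 0 < 2 ^ a := by positivity
  set b := 2 ^ a with hb
  set U : Finset (Finset (Fin n)) := (Finset.univ.powerset).filter
    (fun T => b ∣ T.card ∧ 0 < T.card ∧ T.card ≤ m) with hU
  have hUm : ∀ T ∈ U, b ∣ T.card ∧ 0 < T.card ∧ T.card ≤ m := fun T hT =>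
    (Finset.mem_filter.1 hT).2
  have hdisj : (U : Set (Finset (Fin n))).PairwiseDisjoint (fun T => glued b T) := by
    intro T hT T' hT' hne
    rw [Function.onFun, Finset.disjoint_left]
    intro g hg hg'
    apply hne
    have e : ∀ T ∈ U, g ∈ glued b T → ∀ x, x ∈ T ↔ b ∣ Function.minimalPeriod g x := by
      intro T hT hg x
      constructor
      · intro hx
        rw [(mem_glued hg).1 x hx]
        exact (hUm T hT).1
      · intro h
        by_contra hx
        exact (mem_glued hg).2.1 x hx h
    ext y
    rw [e T hT hg, e T' hT' hg']
  have hsub : U.biUnion (fun T => glued b T) ⊆ B := by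
    intro g hg
    rw [Finset.mem_biUnion] at hg
    obtain ⟨T, hT, hg⟩ := hg
    obtain ⟨h1, h2, h3⟩ := hUm T hT
    obtain ⟨k1, k2, k3⟩ := glued_order ha (Finset.card_pos.1 h2) h1 hg
    exact hB g k1 k2 (k3 ▸ h3)
  have hcard := Finset.card_le_card hsub
  rw [Finset.card_biUnion hdisj] at hcard
  have hterm : ∀ T ∈ U, (((T.card - 1).factorial : ℝ) * (((n - T.card).factorial : ℝ) *
      c0)) ≤ ((glued b T).card : ℝ) := by
    intro T hT
    have h1 := card_glued b (T := T) (Finset.card_pos.1 (hUm T hT).2.1) inferInstance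
    have hcd : Fintype.card {y // ¬ y ∈ T} = n - T.card := by
      rw [Fintype.card_subtype_compl, Fintype.card_coe, Fintype.card_fin]
    have h2 := card_bfree b hb0 (n - T.card) {y // ¬ y ∈ T} hcd
    have h3 := hc ((n - T.card) / b) ((Nat.div_le_self _ _).trans (Nat.sub_le _ _))
    calc _ ≤ ((T.card - 1).factorial : ℝ) * (((n - T.card).factorial : ℝ) *
            cprod b ((n - T.card) / b)) := by gcongr
      _ ≤ ((T.card - 1).factorial : ℝ) * ((bfree b {y // ¬ y ∈ T}).card : ℝ) := by gcongr
      _ ≤ _ := by exact_mod_cast h1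
  have hsum : (n.factorial : ℝ) * (c0 * (1 / (b : ℕ) *
      ∑ i ∈ Finset.range (m / b), 1 / ((i : ℝ) + 1))) ≤
      ∑ T ∈ U, (((T.card - 1).factorial : ℝ) * (((n - T.card).factorial : ℝ) * c0)) := by
    rw [hU, Finset.sum_filter]
    rw [Finset.sum_powerset_apply_card (fun k => if b ∣ k ∧ 0 < k ∧ k ≤ m then
      (((k - 1).factorial : ℝ) * (((n - k).factorial : ℝ) * c0)) else 0)]
    rw [Finset.card_univ, Fintype.card_fin]
    have hinj : Set.InjOn (fun i => b * (i + 1)) (Finset.range (m / b) : Set ℕ) := by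
      intro i _ j _ hij
      have := Nat.eq_of_mul_eq_mul_left hb0 hij
      omega
    have hle : ∀ i ∈ Finset.range (m / b), b * (i + 1) ≤ m := by
      intro i hi
      rw [Finset.mem_range] at hi
      calc b * (i + 1) ≤ b * (m / b) := Nat.mul_le_mul_left _ hi
        _ ≤ m := Nat.mul_div_le m b
    have hss : (Finset.range (m / b)).image (fun i => b * (i + 1)) ⊆ Finset.range (n + 1) := by
      intro k hk
      rw [Finset.mem_image] at hk
      obtain ⟨i, hi, rfl⟩ := hk
      have := hle i hi
      rw [Finset.mem_range]
      omega
    refine le_trans ?_ (Finset.sum_le_sum_of_subset_of_nonneg hss ?_)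
    · rw [Finset.sum_image hinj, Finset.mul_sum, Finset.mul_sum, Finset.mul_sum]
      apply Finset.sum_le_sum
      intro i hi
      have h1 := hle i hi
      have h2 : 0 < b * (i + 1) := by positivity
      rw [if_pos ⟨dvd_mul_right _ _, h2, h1⟩]
      have e3 := Nat.choose_mul_factorial_mul_factorial (n := n) (k := b * (i + 1)) (by omega)
      have e4 := Nat.mul_factorial_pred h2.ne'
      rw [← e3, ← e4, nsmul_eq_mul]
      have : (b : ℝ) ≠ 0 := by positivity
      apply le_of_eq
      push_cast
      field_simp
    · intro k _ _
      split_ifs <;> positivity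
  refine hsum.trans ?_
  calc _ ≤ ∑ T ∈ U, ((glued b T).card : ℝ) := Finset.sum_le_sum hterm
    _ ≤ _ := by exact_mod_cast hcard

lemma cprod_lb (b : ℕ) (hb : 1 ≤ b) (q : ℕ) :
    (1 - 1 / (b : ℝ)) * ((q : ℝ) + 1) ^ (-(1 / (b : ℝ))) ≤ cprod b (q + 1) := by
  have hb' : (1 : ℝ) ≤ b := by exact_mod_cast hb
  have hib : 1 / (b : ℝ) ≤ 1 := by rw [div_le_one (by positivity)]; exact hb'
  induction q with
  | zero => simp [cprod]
  | succ q ih =>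
    rw [cprod_succ]
    have hq : (0 : ℝ) < (q : ℝ) + 1 := by positivity
    have bern : (1 + (-1 / ((q : ℝ) + 2))) ^ (1 / (b : ℝ)) ≤ 1 + 1 / (b : ℝ) * (-1 / ((q : ℝ) + 2)) := by
      apply rpow_one_add_le_one_add_mul_self _ (by positivity) hib
      rw [le_div_iff₀ (by positivity)]
      linarith
    have e1 : (1 + (-1 / ((q : ℝ) + 2))) = ((q : ℝ) + 1) / ((q : ℝ) + 2) := by field_simp; ring
    rw [e1, Real.div_rpow hq.le (by positivity)] at bern
    have e2 : ((q + 1 : ℕ) : ℝ) + 1 = (q : ℝ) + 2 := by push_cast; ring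
    rw [e2]
    have h0 : 0 ≤ 1 - 1 / (((q : ℝ) + 2) * b) := by
      rw [sub_nonneg, div_le_one (by positivity)]
      nlinarith
    refine le_trans ?_ (mul_le_mul_of_nonneg_right ih h0)
    rw [mul_assoc]
    apply mul_le_mul_of_nonneg_left _ (by linarith)
    have e3 : 1 - 1 / (((q : ℝ) + 2) * b) = 1 + 1 / (b : ℝ) * (-1 / ((q : ℝ) + 2)) := by
      field_simp; ring
    rw [e3]
    refine le_trans (le_of_eq ?_) (mul_le_mul_of_nonneg_left bern (by positivity))
    rw [Real.rpow_neg hq.le, Real.rpow_neg (by positivity)]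
    have : ((q : ℝ) + 1) ^ (1 / (b : ℝ)) ≠ 0 := by positivity
    field_simp

lemma cprod_lb' (b n : ℕ) (hb : 4 ≤ b) (hbn : Real.log n ≤ b) (q : ℕ) (hq : q ≤ n) :
    3 / 4 * (1 / Real.exp 1) ≤ cprod b q := by
  have hb' : (4 : ℝ) ≤ b := by exact_mod_cast hb
  have he : 1 / Real.exp 1 ≤ 1 := by
    rw [div_le_one (Real.exp_pos _)]; exact Real.one_le_exp (by norm_num)
  rcases q with _ | q
  · simp only [cprod, Finset.range_zero, Finset.prod_empty]; linarith
  refine le_trans ?_ (cprod_lb b (by omega) q)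
  have h1 : 1 / (b : ℝ) ≤ 1 / 4 := by gcongr
  have hq1 : (q : ℝ) + 1 ≤ n := by exact_mod_cast hq
  have h2 : 1 / Real.exp 1 ≤ ((q : ℝ) + 1) ^ (-(1 / (b : ℝ))) := by
    rw [Real.rpow_def_of_pos (by positivity), one_div, ← Real.exp_neg, Real.exp_le_exp]
    have : Real.log ((q : ℝ) + 1) ≤ b := (Real.log_le_log (by positivity) hq1).trans hbn
    have : Real.log ((q : ℝ) + 1) * (1 / b) ≤ 1 := by
      rw [mul_one_div, div_le_one (by positivity)]; exact this
    linarith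
  have h3 : 0 ≤ 1 / Real.exp 1 := by positivity
  apply mul_le_mul _ h2 h3 <;> linarith

theorem stmt8 (ε : ℝ) (hε : ε ∈ Set.Ioo (0 : ℝ) 1) (n : ℕ)
    (h1 : ⌈(Real.log n + 1) ^ 2⌉ < ⌈(n : ℝ) ^ ε⌉)
    (h2 : ⌈(n : ℝ) ^ ε⌉ ≤ (n : ℤ) - 2 * ⌈Real.log n⌉) :
    symPropn n ε > ε / (16 * Real.log 2) * (1 / Real.exp 1 - 1 / n) := by
  classical
  obtain ⟨hε0, hε1⟩ := hε
  obtain ⟨m, hm⟩ : ∃ m : ℕ, ⌈(n : ℝ) ^ ε⌉ = m :=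
    ⟨_, (Int.toNat_of_nonneg (Int.ceil_nonneg (by positivity))).symm⟩
  set L := Real.log n with hL
  have hln2 := Real.log_two_gt_d9
  have hL0 : 0 ≤ L := Real.log_natCast_nonneg n
  have hmL : (L + 1) ^ 2 < m := by
    rw [hm] at h1
    calc (L + 1) ^ 2 ≤ (⌈(L + 1) ^ 2⌉ : ℝ) := Int.le_ceil _
      _ < ((m : ℤ) : ℝ) := by exact_mod_cast h1
      _ = m := by simp
  have hmn' : (m : ℝ) + 2 * L ≤ n := by
    rw [hm] at h2
    have h3 : (m : ℝ) ≤ n - 2 * (⌈L⌉ : ℝ) := by exact_mod_cast h2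
    have := Int.le_ceil L
    linarith
  have hmn : m ≤ n := by
    have : (m : ℝ) ≤ n := by linarith
    exact_mod_cast this
  have hn8 : 8 ≤ n := by
    by_contra hlt
    have hlt : n ≤ 7 := by omega
    have hge : 2 ≤ n := by
      have : (1 : ℝ) < n := by nlinarith
      exact_mod_cast this
    rcases Nat.lt_or_ge n 4 with h4 | h4
    · have : Real.log 2 ≤ L := Real.log_le_log (by norm_num) (by exact_mod_cast hge)
      have : (n : ℝ) ≤ 3 := by exact_mod_cast (by omega : n ≤ 3)
      nlinarith
    · have h5 : Real.log 4 ≤ L := Real.log_le_log (by norm_num) (by exact_mod_cast h4)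
      have h6 : Real.log 4 = 2 * Real.log 2 := by
        rw [show (4 : ℝ) = 2 ^ 2 by norm_num, Real.log_pow]; simp
      have : (n : ℝ) ≤ 7 := by exact_mod_cast hlt
      nlinarith
  have hL2 : 2 < L := by
    have h5 : Real.log 8 ≤ L := Real.log_le_log (by norm_num) (by exact_mod_cast hn8)
    have h6 : Real.log 8 = 3 * Real.log 2 := by
      rw [show (8 : ℝ) = 2 ^ 3 by norm_num, Real.log_pow]; simp
    linarith
  obtain ⟨a, ha1, ha2⟩ := exists_nat_pow_near (by linarith : (1 : ℝ) ≤ L) (by norm_num : (1 : ℝ) < 2)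
  have ha0 : 1 ≤ a := by
    by_contra h
    have : a = 0 := by omega
    subst this
    norm_num at ha2
    linarith
  set b : ℕ := 2 ^ (a + 1) with hb
  have hbR : (b : ℝ) = 2 * 2 ^ a := by rw [hb]; push_cast; ring
  have hbL : (b : ℝ) ≤ 2 * L := by linarith
  have hLb : L ≤ b := by rw [hb]; push_cast; exact ha2.le
  have hb4 : 4 ≤ b := by
    calc 4 = 2 ^ 2 := by norm_num
      _ ≤ 2 ^ (a + 1) := Nat.pow_le_pow_right (by norm_num) (by omega)
  have hb0 : (0 : ℝ) < b := by positivity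
  have hbm : b ≤ m := by
    have : (b : ℝ) ≤ m := by nlinarith
    exact_mod_cast this
  have hn0 : (0 : ℝ) < n := by exact_mod_cast (by omega : 0 < n)
  have hm0 : (0 : ℝ) < m := by nlinarith
  -- harmonic sum
  set M := m / b with hM
  have hharm : ε * L / 4 ≤ ∑ i ∈ Finset.range M, 1 / ((i : ℝ) + 1) := by
    have hh : Real.log ((M + 1 : ℕ) : ℝ) ≤ ∑ i ∈ Finset.range M, 1 / ((i : ℝ) + 1) := by
      have := log_add_one_le_harmonic M
      rw [harmonic] at this
      push_cast at this ⊢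
      simpa using this
    have hM1 : 1 ≤ M := (Nat.one_le_div_iff (by omega)).2 hbm
    have hMR : (1 : ℝ) ≤ M := by exact_mod_cast hM1
    have hMb : (m : ℝ) ≤ b * ((M : ℝ) + 1) := by
      have := Nat.lt_mul_div_succ m (by omega : 0 < b)
      exact_mod_cast this.le
    have hlm : ε * L ≤ Real.log m := by
      rw [hL, ← Real.log_rpow hn0]
      apply Real.log_le_log (by positivity)
      have := Int.le_ceil ((n : ℝ) ^ ε)
      rw [hm] at this
      exact_mod_cast this
    have hb2 : (b : ℝ) ^ 2 ≤ 4 * m := by nlinarith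
    have h4 : (m : ℝ) ≤ ((M : ℝ) + 1) ^ 4 := by
      have e1 : (m : ℝ) ^ 2 ≤ 4 * m * ((M : ℝ) + 1) ^ 2 := by
        calc (m : ℝ) ^ 2 ≤ (b * ((M : ℝ) + 1)) ^ 2 := by gcongr
          _ = b ^ 2 * ((M : ℝ) + 1) ^ 2 := by ring
          _ ≤ _ := by gcongr
      have e2 : (m : ℝ) ≤ 4 * ((M : ℝ) + 1) ^ 2 := by
        by_contra h
        push Not at h
        nlinarith
      have e3 : (4 : ℝ) ≤ ((M : ℝ) + 1) ^ 2 := by nlinarith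
      nlinarith [sq_nonneg ((M : ℝ) + 1)]
    have h5 : Real.log m ≤ 4 * Real.log ((M : ℝ) + 1) := by
      have := Real.log_le_log hm0 h4
      rw [Real.log_pow] at this
      exact_mod_cast this
    push_cast at hh
    linarith
  have hcnt := main_count (a + 1) (by omega) n m hmn (3 / 4 * (1 / Real.exp 1)) (by positivity)
    (fun q hq => cprod_lb' b n hb4 hLb q hq)
    (Finset.univ.filter fun g : Equiv.Perm (Fin n) => Even (orderOf g) ∧
      orderOf (g ^ (orderOf g / 2)) = 2 ∧
      (((g ^ (orderOf g / 2)).support.card : ℤ) ≤ ⌈(n : ℝ) ^ ε⌉))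
    (by
      intro g k1 k2 k3
      rw [Finset.mem_filter]
      refine ⟨Finset.mem_univ _, k1, k2, ?_⟩
      rw [hm]
      exact_mod_cast k3)
  have hfac : (0 : ℝ) < n.factorial := by positivity
  have hp : 3 / 4 * (1 / Real.exp 1) * (1 / (b : ℝ) *
      ∑ i ∈ Finset.range M, 1 / ((i : ℝ) + 1)) ≤ symPropn n ε := by
    rw [symPropn, Nat.card_eq_fintype_card, Nat.card_eq_fintype_card, Fintype.card_perm,
      Fintype.card_fin, le_div_iff₀ hfac, Fintype.card_subtype, mul_comm]
    convert hcnt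
  have hx : ε / 8 ≤ 1 / (b : ℝ) * ∑ i ∈ Finset.range M, 1 / ((i : ℝ) + 1) := by
    rw [one_div, inv_mul_eq_div, le_div_iff₀ hb0]
    nlinarith
  have he : 0 < 1 / Real.exp 1 := by positivity
  have hlow : 3 / 4 * (1 / Real.exp 1) * (ε / 8) ≤ symPropn n ε :=
    le_trans (mul_le_mul_of_nonneg_left hx (by positivity)) hp
  have hk : ε / (16 * Real.log 2) ≤ 3 / 32 * ε := by
    rw [div_le_iff₀ (by positivity)]
    nlinarith
  have hk0 : 0 < ε / (16 * Real.log 2) := by positivity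
  have hn1 : 0 < 1 / (n : ℝ) := by positivity
  calc ε / (16 * Real.log 2) * (1 / Real.exp 1 - 1 / n)
      < ε / (16 * Real.log 2) * (1 / Real.exp 1) := by
        apply mul_lt_mul_of_pos_left _ hk0; linarith
    _ ≤ 3 / 32 * ε * (1 / Real.exp 1) := by gcongr
    _ = 3 / 4 * (1 / Real.exp 1) * (ε / 8) := by ring
    _ ≤ _ := hlow
end

section
/- Let ε ∈ (0,1) and let n be an integer satisfying ⌈(log(n)+1)²⌉ < ⌈n^ε⌉ ≤ n − 2⌈log(n)⌉. Then p̃(n,ε) > (2/3) · (ε/(16·log(2))) · (1/e − 1/√n). -/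
/-- The proportion of elements `g` of the alternating group `Aₙ` such that `g` has even
order and `g^(|g|/2)` is an involution whose support has cardinality at most `⌈n^ε⌉`. -/
noncomputable def altPropn (n : ℕ) (ε : ℝ) : ℝ :=
  (Nat.card {g : alternatingGroup (Fin n) //
      Even (orderOf g) ∧ orderOf (g ^ (orderOf g / 2)) = 2 ∧
      ((((g ^ (orderOf g / 2) : alternatingGroup (Fin n)) :
          Equiv.Perm (Fin n)).support.card : ℤ) ≤ ⌈(n : ℝ) ^ ε⌉)} : ℝ) /
    Nat.card (alternatingGroup (Fin n))

theorem aux_half {a r M : ℕ} (h1 : ¬ 2 ^ a ∣ r) (h2 : 2 ^ a ∣ M) (h3 : r ∣ M) : r ∣ M / 2 := by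
  obtain ⟨s, rfl⟩ := h3
  rcases Nat.even_or_odd s with ⟨t, ht⟩ | hs
  · refine ⟨t, ?_⟩
    have : r * s = 2 * (r * t) := by rw [ht]; ring
    omega
  · exfalso
    apply h1
    have hc : Nat.Coprime (2 ^ a) s := Nat.Coprime.pow_left _ (Nat.coprime_two_left.mpr hs)
    exact hc.dvd_of_dvd_mul_right h2

theorem aux_lcm {a x y : ℕ} (ha : 1 ≤ a) (h : 2 ^ a ∣ Nat.lcm x y) : 2 ^ a ∣ x ∨ 2 ^ a ∣ y := by
  by_contra hc
  push Not at hc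
  have hx := aux_half hc.1 h (Nat.dvd_lcm_left x y)
  have hy := aux_half hc.2 h (Nat.dvd_lcm_right x y)
  have hM := Nat.lcm_dvd hx hy
  have hx0 : 0 < x := Nat.pos_of_ne_zero (fun h0 => hc.1 (h0 ▸ dvd_zero _))
  have hy0 : 0 < y := Nat.pos_of_ne_zero (fun h0 => hc.2 (h0 ▸ dvd_zero _))
  have hp := Nat.lcm_pos hx0 hy0
  have h2 : 2 ∣ Nat.lcm x y := (dvd_pow_self 2 (by omega)).trans h
  have := Nat.le_of_dvd (by omega) hM
  omega

theorem aux_mslcm {a : ℕ} (ha : 1 ≤ a) (s : Multiset ℕ) (h : 2 ^ a ∣ s.lcm) :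
    ∃ r ∈ s, 2 ^ a ∣ r := by
  induction s using Multiset.induction_on with
  | empty =>
    exfalso
    simp at h
    omega
  | cons b s ih =>
    rw [Multiset.lcm_cons] at h
    rcases aux_lcm ha h with h | h
    · exact ⟨b, by simp, h⟩
    · obtain ⟨r, hr, hr'⟩ := ih h
      exact ⟨r, by simp [hr], hr'⟩

theorem cnt_cyc {β : Type*} [Fintype β] [DecidableEq β] (l : ℕ) (h2 : 2 ≤ l)
    (hl : l ≤ Fintype.card β) :
    ((Finset.univ.filter (fun g : Equiv.Perm β => g.cycleType = {l})).card : ℝ) *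
      ((Fintype.card β - l).factorial : ℝ) = ((Fintype.card β).factorial : ℝ) / l := by
  rw [Equiv.Perm.card_of_cycleType_singleton h2 hl]
  rw [eq_div_iff (by positivity)]
  norm_cast
  rw [← Nat.choose_mul_factorial_mul_factorial hl, ← Nat.mul_factorial_pred (n := l) (by omega)]
  ring

theorem cnt_sgn {β : Type*} [Fintype β] [DecidableEq β] (h2 : 2 ≤ Fintype.card β) (s : ℤˣ) :
    ((Finset.univ.filter (fun g : Equiv.Perm β => Equiv.Perm.sign g = s)).card : ℝ) =
      ((Fintype.card β).factorial : ℝ) / 2 := by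
  have : Nontrivial β := Fintype.one_lt_card_iff_nontrivial.mp (by omega)
  have h1 : 2 * (Finset.univ.filter (fun g : Equiv.Perm β => Equiv.Perm.sign g = 1)).card =
      (Fintype.card β).factorial := by
    rw [← Fintype.card_perm, ← two_mul_card_alternatingGroup]
    congr 1
    exact (Fintype.card_of_subtype _ (by simp [Equiv.Perm.mem_alternatingGroup])).symm
  have h3 := Finset.card_filter_add_card_filter_not (s := (Finset.univ : Finset (Equiv.Perm β)))
    (fun g : Equiv.Perm β => Equiv.Perm.sign g = 1)
  rw [Finset.card_univ, Fintype.card_perm] at h3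
  have h4 : Finset.univ.filter (fun g : Equiv.Perm β => ¬ Equiv.Perm.sign g = 1) =
      Finset.univ.filter (fun g : Equiv.Perm β => Equiv.Perm.sign g = -1) := by
    ext g
    simp only [Finset.mem_filter, Finset.mem_univ, true_and]
    rcases Int.units_eq_one_or (Equiv.Perm.sign g) with h | h <;> simp [h]
  rw [h4] at h3
  rw [eq_div_iff (by norm_num)]
  rcases Int.units_eq_one_or s with rfl | rfl <;> norm_cast <;> omega

theorem cnt_sgn_le {β : Type*} [Fintype β] [DecidableEq β] (s : ℤˣ) :
    ((Finset.univ.filter (fun g : Equiv.Perm β => Equiv.Perm.sign g = s)).card : ℝ) ≤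
      ((Fintype.card β).factorial : ℝ) / 2 * (1 + if Fintype.card β ≤ 1 then 1 else 0) := by
  split_ifs with h
  · have := Finset.card_le_univ (Finset.univ.filter (fun g : Equiv.Perm β => Equiv.Perm.sign g = s))
    rw [Fintype.card_perm] at this
    have : ((Finset.univ.filter (fun g : Equiv.Perm β => Equiv.Perm.sign g = s)).card : ℝ) ≤
      ((Fintype.card β).factorial : ℝ) := by exact_mod_cast this
    linarith
  · rw [cnt_sgn (by omega)]
    simp

theorem card_sub {β : Type*} [Fintype β] [DecidableEq β] (c : Equiv.Perm β) :
    Fintype.card {x // x ∉ c.support} = Fintype.card β - c.support.card := by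
  rw [Fintype.card_subtype_compl, Fintype.card_coe]

theorem cyc_of_type {β : Type*} [Fintype β] [DecidableEq β] {c : Equiv.Perm β} {l : ℕ}
    (h : c.cycleType = {l}) : c.IsCycle ∧ c.support.card = l := by
  constructor
  · rw [← Equiv.Perm.card_cycleType_eq_one, h]; simp
  · rw [← Equiv.Perm.sum_cycleType, h]; simp

theorem disj_ofSub {β : Type*} [Fintype β] [DecidableEq β] (c : Equiv.Perm β)
    (u : Equiv.Perm {x // x ∉ c.support}) : c.Disjoint (Equiv.Perm.ofSubtype u) := by
  intro x
  by_cases hx : x ∈ c.support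
  · right
    exact Equiv.Perm.ofSubtype_apply_of_not_mem u (by simpa using hx)
  · left
    simpa using hx

theorem bad_le {β : Type*} [Fintype β] [DecidableEq β] (a : ℕ) (ha : 1 ≤ a) :
    ((Finset.univ.filter (fun h : Equiv.Perm β => Equiv.Perm.sign h = -1 ∧ 2 ^ a ∣ orderOf h)).card
      : ℝ) ≤ ((Fintype.card β).factorial : ℝ) / 2 *
        ∑ j ∈ Finset.Icc 1 (Fintype.card β / 2 ^ a),
          (1 + if Fintype.card β - 2 ^ a * j ≤ 1 then (1 : ℝ) else 0) / ((2 ^ a * j : ℕ) : ℝ) := by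
  have hk : 2 ≤ 2 ^ a := by
    calc 2 = 2 ^ 1 := by norm_num
      _ ≤ 2 ^ a := Nat.pow_le_pow_right (by norm_num) ha
  have hsub : Finset.univ.filter
      (fun h : Equiv.Perm β => Equiv.Perm.sign h = -1 ∧ 2 ^ a ∣ orderOf h) ⊆
      (Finset.Icc 1 (Fintype.card β / 2 ^ a)).biUnion (fun j =>
        (Finset.univ.filter (fun c : Equiv.Perm β => c.cycleType = {2 ^ a * j})).biUnion (fun c =>
          (Finset.univ.filter (fun u : Equiv.Perm {x // x ∉ c.support} =>
            Equiv.Perm.sign u = 1)).image (fun u => c * Equiv.Perm.ofSubtype u))) := by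
    intro h hh
    simp only [Finset.mem_filter, Finset.mem_univ, true_and] at hh
    obtain ⟨hs, hd⟩ := hh
    rw [← Equiv.Perm.lcm_cycleType] at hd
    obtain ⟨r, hr, hr'⟩ := aux_mslcm ha _ hd
    obtain ⟨c, t, rfl, hct, hc, hcr⟩ := Equiv.Perm.mem_cycleType_iff.mp hr
    obtain ⟨j, hj⟩ := hr'
    have hr2 : 2 ≤ r := hcr ▸ hc.two_le_card_support
    have hrn : r ≤ Fintype.card β := hcr ▸ Finset.card_le_univ _
    have hj1 : 1 ≤ j := by
      rcases Nat.eq_zero_or_pos j with h0 | h0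
      · subst h0; omega
      · exact h0
    simp only [Finset.mem_biUnion, Finset.mem_Icc, Finset.mem_filter, Finset.mem_univ, true_and,
      Finset.mem_image]
    refine ⟨j, ⟨hj1, ?_⟩, c, ?_, ?_⟩
    · rw [Nat.le_div_iff_mul_le (by omega), mul_comm, ← hj]
      exact hrn
    · rw [hc.cycleType, hcr, hj]
    · have hpt : ∀ x, t x ∉ c.support ↔ x ∉ c.support := by
        intro x
        rcases hct x with h | h
        · have h1 : x ∉ c.support := by simpa using h
          have h2 : t x ∉ c.support := by
            rcases hct (t x) with h' | h'
            · simpa using h'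
            · have := t.injective h'
              rw [this]; exact h1
          simp only [h1, h2]
        · rw [h]
      have hot : Equiv.Perm.ofSubtype (Equiv.Perm.subtypePerm (p := fun x => x ∉ c.support) t hpt) = t := by
        apply Equiv.Perm.ofSubtype_subtypePerm
        intro x hx
        rcases hct x with h | h
        · simpa using h
        · exact absurd h hx
      refine ⟨Equiv.Perm.subtypePerm (p := fun x => x ∉ c.support) t hpt, ?_, ?_⟩
      · rw [← Equiv.Perm.sign_ofSubtype, hot]
        rw [Equiv.Perm.sign_mul, hc.sign, hcr] at hs
        have he : Even r := by
          rw [hj]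
          exact ((Nat.even_pow.mpr ⟨even_two, by omega⟩)).mul_right j
        rw [he.neg_one_pow] at hs
        simpa using hs
      · rw [hot]
  have h1 := (Finset.card_le_card hsub).trans Finset.card_biUnion_le
  have h2 : ((Finset.univ.filter (fun h : Equiv.Perm β => Equiv.Perm.sign h = -1 ∧
      2 ^ a ∣ orderOf h)).card : ℝ) ≤ _ := Nat.cast_le.mpr h1
  refine h2.trans ?_
  rw [Nat.cast_sum, Finset.mul_sum]
  apply Finset.sum_le_sum
  intro j hj
  rw [Finset.mem_Icc] at hj
  have hjn : 2 ^ a * j ≤ Fintype.card β := by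
    rw [mul_comm]; exact (Nat.le_div_iff_mul_le (by omega)).mp hj.2
  have hj2 : 2 ≤ 2 ^ a * j := le_trans hk (Nat.le_mul_of_pos_right _ hj.1)
  refine (Nat.cast_le.mpr Finset.card_biUnion_le).trans ?_
  rw [Nat.cast_sum]
  have hterm : ∀ c ∈ Finset.univ.filter (fun c : Equiv.Perm β => c.cycleType = {2 ^ a * j}),
      ((((Finset.univ.filter (fun u : Equiv.Perm {x // x ∉ c.support} =>
            Equiv.Perm.sign u = 1)).image (fun u => c * Equiv.Perm.ofSubtype u)).card : ℕ) : ℝ) ≤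
      ((Fintype.card β - 2 ^ a * j).factorial : ℝ) / 2 *
        (1 + if Fintype.card β - 2 ^ a * j ≤ 1 then (1 : ℝ) else 0) := by
    intro c hc
    simp only [Finset.mem_filter, Finset.mem_univ, true_and] at hc
    refine (Nat.cast_le.mpr Finset.card_image_le).trans ?_
    have := cnt_sgn_le (β := {x // x ∉ c.support}) 1
    rw [card_sub, (cyc_of_type hc).2] at this
    exact this
  refine (Finset.sum_le_card_nsmul _ _ _ hterm).trans (le_of_eq ?_)
  have := cnt_cyc (β := β) (2 ^ a * j) hj2 hjn
  rw [nsmul_eq_mul, ← mul_assoc, mul_div_assoc', this]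
  ring

theorem good_ge {α : Type*} [Fintype α] [DecidableEq α] (a : ℕ) (ha : 1 ≤ a) (R : ℕ) :
    ∑ j ∈ Finset.Icc 1 R, ∑ c ∈ Finset.univ.filter
      (fun c : Equiv.Perm α => c.cycleType = {2 ^ a * j}),
      (Finset.univ.filter (fun u : Equiv.Perm {x // x ∉ c.support} =>
        Equiv.Perm.sign u = -1 ∧ ¬ 2 ^ a ∣ orderOf u)).card ≤
    (Finset.univ.filter (fun g : Equiv.Perm α => Equiv.Perm.sign g = 1 ∧ Even (orderOf g) ∧
      orderOf (g ^ (orderOf g / 2)) = 2 ∧ (g ^ (orderOf g / 2)).support.card ≤ 2 ^ a * R)).card := by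
  simp_rw [← Finset.card_sigma]
  apply Finset.card_le_card_of_injOn (fun p => p.2.1 * Equiv.Perm.ofSubtype p.2.2)
  · rintro ⟨j, c, u⟩ h
    simp only [Finset.coe_sigma, Set.mem_sigma_iff, Finset.mem_coe, Finset.mem_Icc,
      Finset.mem_filter, Finset.mem_univ, true_and] at h
    obtain ⟨hj, hc, hu, hou⟩ := h
    obtain ⟨hcyc, hcard⟩ := cyc_of_type hc
    have hdis := disj_ofSub c u
    have hord : orderOf (Equiv.Perm.ofSubtype u) = orderOf u :=
      orderOf_injective _ Equiv.Perm.ofSubtype_injective u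
    have hev : Even (2 ^ a * j) := (Nat.even_pow.mpr ⟨even_two, by omega⟩).mul_right j
    simp only [Finset.coe_filter, Finset.mem_univ, true_and, Set.mem_ofPred_eq]
    set g := c * Equiv.Perm.ofSubtype u with hg
    have hog : orderOf g = Nat.lcm (2 ^ a * j) (orderOf u) := by
      rw [hg, hdis.orderOf, hord, hcyc.orderOf, hcard]
    have hkg : 2 ^ a ∣ orderOf g := by
      rw [hog]; exact (Dvd.intro j rfl).trans (Nat.dvd_lcm_left _ _)
    have h2g : 2 ∣ orderOf g := (dvd_pow_self 2 (by omega)).trans hkg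
    refine ⟨?_, even_iff_two_dvd.mpr h2g, ?_, ?_⟩
    · rw [hg, Equiv.Perm.sign_mul, Equiv.Perm.sign_ofSubtype, hu, hcyc.sign, hcard,
        hev.neg_one_pow]
      simp
    · have hpos := orderOf_pos g
      rw [orderOf_pow_of_dvd (by omega) (Nat.div_dvd_of_dvd h2g)]
      exact Nat.div_div_self h2g (by omega)
    · have hd : orderOf u ∣ orderOf g / 2 :=
        aux_half hou hkg (by rw [hog]; exact Nat.dvd_lcm_right _ _)
      have hpow : g ^ (orderOf g / 2) = c ^ (orderOf g / 2) := by
        conv_lhs => rw [hg]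
        rw [hdis.commute.mul_pow]
        have : (Equiv.Perm.ofSubtype u) ^ (orderOf g / 2) = 1 := by
          rw [← orderOf_dvd_iff_pow_eq_one, hord]; exact hd
        rw [← hg, this, mul_one]
      rw [hpow]
      refine (Finset.card_le_card (Equiv.Perm.support_pow_le c _)).trans ?_
      rw [hcard]
      exact Nat.mul_le_mul_left _ hj.2
  · rintro ⟨j, c, u⟩ h ⟨j', c', u'⟩ h' heq
    simp only [Finset.coe_sigma, Set.mem_sigma_iff, Finset.mem_coe, Finset.mem_Icc,
      Finset.mem_filter, Finset.mem_univ, true_and] at h h'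
    obtain ⟨hj, hc, hu, hou⟩ := h
    obtain ⟨hj', hc', hu', hou'⟩ := h'
    obtain ⟨hcyc, hcard⟩ := cyc_of_type hc
    obtain ⟨hcyc', hcard'⟩ := cyc_of_type hc'
    simp only at heq
    have hdis := disj_ofSub c u
    have hdis' := disj_ofSub c' u'
    have hcc : c = c' := by
      have hm : c' ∈ (c' * Equiv.Perm.ofSubtype u').cycleFactorsFinset := by
        rw [hdis'.cycleFactorsFinset_mul_eq_union, hcyc'.cycleFactorsFinset_eq_singleton]
        simp
      rw [← heq, hdis.cycleFactorsFinset_mul_eq_union, hcyc.cycleFactorsFinset_eq_singleton,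
        Finset.mem_union, Finset.mem_singleton] at hm
      rcases hm with hm | hm
      · exact hm.symm
      · exfalso
        apply hou
        have hord : orderOf (Equiv.Perm.ofSubtype u) = orderOf u :=
          orderOf_injective _ Equiv.Perm.ofSubtype_injective u
        rw [← hord, ← Equiv.Perm.lcm_cycleType]
        have : c'.support.card ∈ (Equiv.Perm.ofSubtype u).cycleType := by
          rw [Equiv.Perm.cycleType_def]
          exact Multiset.mem_map.mpr ⟨c', hm, rfl⟩
        refine dvd_trans ?_ (Multiset.dvd_lcm this)
        rw [hcard']
        exact Dvd.intro _ rfl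
    subst hcc
    have huu := Equiv.Perm.ofSubtype_injective (mul_left_cancel heq)
    subst huu
    have hjj : j = j' := by
      have := hcard.symm.trans hcard'
      exact Nat.eq_of_mul_eq_mul_left (by positivity) this
    subst hjj
    rfl

theorem harm_Icc (q : ℕ) : (∑ j ∈ Finset.Icc 1 q, (1 : ℝ) / j) = ((harmonic q : ℚ) : ℝ) := by
  rw [harmonic_eq_sum_Icc]
  push_cast
  simp

theorem S_le (m k : ℕ) (hk : 2 ≤ k) :
    ∑ j ∈ Finset.Icc 1 (m / k),
      (1 + if m - k * j ≤ 1 then (1 : ℝ) else 0) / ((k * j : ℕ) : ℝ) ≤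
      (((harmonic (m / k) : ℚ) : ℝ) + 1) / k := by
  have hk0 : (0 : ℝ) < k := by positivity
  have h : ∀ j ∈ Finset.Icc 1 (m / k),
      (1 + if m - k * j ≤ 1 then (1 : ℝ) else 0) / ((k * j : ℕ) : ℝ) ≤
      (1 / k) * (1 / j) + (1 / k) * (if j = m / k then 1 else 0) := by
    intro j hj
    rw [Finset.mem_Icc] at hj
    have hj0 : (1 : ℝ) ≤ j := by exact_mod_cast hj.1
    rw [Nat.cast_mul, add_div]
    apply add_le_add
    · apply le_of_eq; field_simp
    · by_cases hjq : j = m / k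
      · rw [if_pos hjq, mul_one]
        apply div_le_div₀ (by norm_num) _ hk0 _
        · split_ifs <;> norm_num
        · nlinarith
      · rw [if_neg hjq, if_neg]
        · simp
        · have h1 : j + 1 ≤ m / k := by omega
          have h2 := (Nat.le_div_iff_mul_le (by omega)).mp h1
          have h3 : (j + 1) * k = k * j + k := by ring
          omega
  refine (Finset.sum_le_sum h).trans ?_
  rw [Finset.sum_add_distrib, ← Finset.mul_sum, ← Finset.mul_sum, harm_Icc, add_div]
  apply add_le_add
  · apply le_of_eq; ring
  · rw [Finset.sum_ite_eq']
    split_ifs <;> simp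

theorem good_real (n a : ℕ) (ha : 1 ≤ a) (R : ℕ) (hR : 2 ^ a * R + 2 ≤ n) (B : ℝ)
    (hB : ∀ m ≤ n, (((harmonic (m / 2 ^ a) : ℚ) : ℝ) + 1) / (2 ^ a : ℕ) ≤ B) :
    (n.factorial : ℝ) / 2 * (((harmonic R : ℚ) : ℝ) / (2 ^ a : ℕ) * (1 - B)) ≤
    ((Finset.univ.filter (fun g : Equiv.Perm (Fin n) => Equiv.Perm.sign g = 1 ∧
      Even (orderOf g) ∧ orderOf (g ^ (orderOf g / 2)) = 2 ∧
      (g ^ (orderOf g / 2)).support.card ≤ 2 ^ a * R)).card : ℝ) := by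
  have hk : 2 ≤ 2 ^ a := by
    calc 2 = 2 ^ 1 := by norm_num
      _ ≤ 2 ^ a := Nat.pow_le_pow_right (by norm_num) ha
  refine le_trans ?_ (Nat.cast_le.mpr (good_ge a ha R))
  rw [Nat.cast_sum, ← harm_Icc, Finset.sum_div, Finset.sum_mul, Finset.mul_sum]
  apply Finset.sum_le_sum
  intro j hj
  rw [Finset.mem_Icc] at hj
  have hjR : 2 ^ a * j ≤ 2 ^ a * R := Nat.mul_le_mul_left _ hj.2
  have hj2 : 2 ≤ 2 ^ a * j := le_trans hk (Nat.le_mul_of_pos_right _ hj.1)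
  rw [Nat.cast_sum]
  have hterm : ∀ c ∈ Finset.univ.filter
      (fun c : Equiv.Perm (Fin n) => c.cycleType = {2 ^ a * j}),
      ((n - 2 ^ a * j).factorial : ℝ) / 2 * (1 - B) ≤
      ((Finset.univ.filter (fun u : Equiv.Perm {x // x ∉ c.support} =>
        Equiv.Perm.sign u = -1 ∧ ¬ 2 ^ a ∣ orderOf u)).card : ℝ) := by
    intro c hc
    simp only [Finset.mem_filter, Finset.mem_univ, true_and] at hc
    have hm : Fintype.card {x // x ∉ c.support} = n - 2 ^ a * j := by
      rw [card_sub, (cyc_of_type hc).2, Fintype.card_fin]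
    have h1 := cnt_sgn (β := {x // x ∉ c.support}) (by omega) (-1)
    have h2 := bad_le (β := {x // x ∉ c.support}) a ha
    have h3 := S_le (Fintype.card {x // x ∉ c.support}) (2 ^ a) hk
    have h4 := hB (Fintype.card {x // x ∉ c.support}) (by omega)
    have h5 := Finset.card_filter_add_card_filter_not
      (s := Finset.univ.filter (fun u : Equiv.Perm {x // x ∉ c.support} =>
        Equiv.Perm.sign u = -1)) (fun u => 2 ^ a ∣ orderOf u)
    rw [Finset.filter_filter, Finset.filter_filter] at h5
    have h5' := congrArg (Nat.cast (R := ℝ)) h5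
    rw [Nat.cast_add, h1] at h5'
    have h6 := h2.trans (mul_le_mul_of_nonneg_left (h3.trans h4) (by positivity))
    rw [hm] at h5' h6
    linarith
  refine le_trans (le_of_eq ?_) (Finset.card_nsmul_le_sum _ _ _ hterm)
  have := cnt_cyc (β := Fin n) (2 ^ a * j) hj2 (by rw [Fintype.card_fin]; omega)
  rw [Fintype.card_fin] at this
  rw [nsmul_eq_mul]
  have hj0 : (j : ℝ) ≠ 0 := by have := hj.1; positivity
  have hk0 : ((2 ^ a : ℕ) : ℝ) ≠ 0 := by positivity
  have e : ∀ x y : ℝ, x * (y / 2 * (1 - B)) = (x * y) / 2 * (1 - B) := by intros; ring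
  rw [e, this, Nat.cast_mul]
  field_simp

theorem prop_ge (n : ℕ) (hn : 2 ≤ n) (ε : ℝ) (K : ℕ) (hK : (K : ℤ) ≤ ⌈(n : ℝ) ^ ε⌉) :
    ((Finset.univ.filter (fun g : Equiv.Perm (Fin n) => Equiv.Perm.sign g = 1 ∧
      Even (orderOf g) ∧ orderOf (g ^ (orderOf g / 2)) = 2 ∧
      (g ^ (orderOf g / 2)).support.card ≤ K)).card : ℝ) / ((n.factorial : ℝ) / 2) ≤
      altPropn n ε := by
  have : Nontrivial (Fin n) := Fin.nontrivial_iff_two_le.mpr hn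
  unfold altPropn
  have hA : (Nat.card (alternatingGroup (Fin n)) : ℝ) = (n.factorial : ℝ) / 2 := by
    have h := two_mul_nat_card_alternatingGroup (α := Fin n)
    rw [Nat.card_eq_fintype_card (α := Equiv.Perm (Fin n)), Fintype.card_perm, Fintype.card_fin] at h
    rw [eq_div_iff (by norm_num)]
    exact_mod_cast (mul_comm _ _).trans h
  rw [hA]
  apply div_le_div_of_nonneg_right _ (by positivity)
  rw [Nat.cast_le, ← Fintype.card_subtype, ← Nat.card_eq_fintype_card]
  refine Nat.card_le_card_of_injective
    (fun g => ⟨⟨g.1, Equiv.Perm.mem_alternatingGroup.mpr g.2.1⟩, ?_, ?_, ?_⟩) ?_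
  · rw [Subgroup.orderOf_mk]; exact g.2.2.1
  · rw [Subgroup.orderOf_mk, ← Subgroup.orderOf_coe]; exact g.2.2.2.1
  · rw [Subgroup.orderOf_mk]
    refine le_trans ?_ hK
    exact_mod_cast g.2.2.2.2
  · intro g g' h
    simp only [Subtype.mk.injEq] at h
    exact Subtype.ext h


theorem stmt9 (ε : ℝ) (hε : ε ∈ Set.Ioo (0 : ℝ) 1) (n : ℕ)
    (h1 : ⌈(Real.log n + 1) ^ 2⌉ < ⌈(n : ℝ) ^ ε⌉)
    (h2 : ⌈(n : ℝ) ^ ε⌉ ≤ (n : ℤ) - 2 * ⌈Real.log n⌉) :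
    altPropn n ε >
      (2 / 3) * (ε / (16 * Real.log 2)) * (1 / Real.exp 1 - 1 / Real.sqrt n) := by
  have hP0 : 0 ≤ altPropn n ε := by unfold altPropn; positivity
  obtain ⟨hε0, hε1⟩ := hε
  have hlog2 : 0 < Real.log 2 := Real.log_pos (by norm_num)
  have hl2a := Real.log_two_gt_d9
  have hl2b := Real.log_two_lt_d9
  have he1 := Real.exp_one_gt_d9
  have hn0 : n ≠ 0 := by
    rintro rfl
    simp [Real.zero_rpow hε0.ne'] at h1
  have hn0' : (0 : ℝ) < n := by positivity
  have hsq : 0 < Real.sqrt n := Real.sqrt_pos.mpr hn0'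
  by_cases h8 : n < 8
  · refine lt_of_lt_of_le ?_ hP0
    apply mul_neg_of_pos_of_neg (by positivity)
    rw [sub_neg]
    apply one_div_lt_one_div_of_lt hsq
    rw [Real.sqrt_lt' (by positivity)]
    have : (n : ℝ) ≤ 7 := by exact_mod_cast (by omega : n ≤ 7)
    nlinarith
  push Not at h8
  set L := Real.log n with hL
  have hL2 : 2 < L := by
    have : Real.log 8 ≤ L := Real.log_le_log (by norm_num) (by exact_mod_cast h8)
    have h88 : Real.log 8 = 3 * Real.log 2 := by
      rw [show (8 : ℝ) = 2 ^ 3 by norm_num, Real.log_pow]; norm_num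
    linarith
  -- the threshold as a natural number
  obtain ⟨N, hN⟩ : ∃ N : ℕ, ⌈(n : ℝ) ^ ε⌉ = (N : ℤ) :=
    ⟨_, (Int.toNat_of_nonneg (Int.ceil_nonneg (by positivity))).symm⟩
  have hN1 : (L + 1) ^ 2 < (N : ℝ) := by
    rw [hN] at h1
    have h3 := Int.le_ceil ((L + 1) ^ 2)
    have h4 : ((⌈(L + 1) ^ 2⌉ : ℤ) : ℝ) < ((N : ℤ) : ℝ) := by exact_mod_cast h1
    push_cast at h4
    linarith
  have hN2 : N + 2 ≤ n := by
    rw [hN] at h2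
    have : (1 : ℤ) ≤ ⌈L⌉ := Int.one_le_ceil_iff.mpr (by linarith)
    omega
  have hN0 : (0 : ℝ) < N := by nlinarith
  have hNlog : ε * L ≤ Real.log N := by
    have h3 := Int.le_ceil ((n : ℝ) ^ ε)
    rw [hN] at h3
    push_cast at h3
    have := Real.log_le_log (by positivity) h3
    rwa [Real.log_rpow hn0'] at this
  -- choice of the power of two
  obtain ⟨b, hb1, hb2⟩ := exists_nat_pow_near (x := 2 * L) (y := (2 : ℝ)) (by linarith) (by norm_num)
  set a := b + 1 with ha
  have hk1 : 2 * L < ((2 ^ a : ℕ) : ℝ) := by push_cast; exact hb2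
  have hk2 : ((2 ^ a : ℕ) : ℝ) ≤ 4 * L := by
    rw [ha]; push_cast; rw [pow_succ]; linarith
  have hk8 : 8 ≤ 2 ^ a := by
    have h4 : (4 : ℝ) < ((2 ^ a : ℕ) : ℝ) := by linarith
    have h4' : 2 ^ 2 < 2 ^ a := by exact_mod_cast h4
    have h3 : 2 < a := (Nat.pow_lt_pow_iff_right (by norm_num)).mp h4'
    calc 8 = 2 ^ 3 := by norm_num
      _ ≤ 2 ^ a := Nat.pow_le_pow_right (by norm_num) h3
  have hgood := good_real n a (by omega) (N / 2 ^ a)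
    (by have := Nat.mul_div_le N (2 ^ a); omega) (1 / 2)
  have hprop := prop_ge n (by omega) ε (2 ^ a * (N / 2 ^ a))
    (by rw [hN]; exact_mod_cast Nat.mul_div_le N (2 ^ a))
  generalize 2 ^ a = k at *
  have hk0 : (0 : ℝ) < k := by linarith
  have hkN : k ≤ N := by
    have : (k : ℝ) < N := by nlinarith [sq_nonneg (L - 1)]
    exact_mod_cast this.le
  have hgood' := hgood (by
    intro m hm
    rw [div_le_iff₀ hk0]
    have h3 := harmonic_le_one_add_log (m / k)
    have h4 : Real.log ((m / k : ℕ) : ℝ) ≤ L - 2 := by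
      rcases Nat.eq_zero_or_pos (m / k) with h0 | h0
      · rw [h0]; simp; linarith
      · have h5 : 8 * ((m / k : ℕ) : ℝ) ≤ n := by
          have h6 : k * (m / k) ≤ m := Nat.mul_div_le m k
          have h7 : 8 * (m / k) ≤ k * (m / k) := Nat.mul_le_mul_right _ hk8
          exact_mod_cast h7.trans (h6.trans hm)
        have h6 := Real.log_le_log (by positivity) h5
        rw [Real.log_mul (by norm_num) (by positivity),
          show (8 : ℝ) = 2 ^ 3 by norm_num, Real.log_pow] at h6
        push_cast at h6
        linarith
    linarith)
  -- lower bound for the harmonic sum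
  have hH : Real.log N / 5 ≤ ((harmonic (N / k) : ℚ) : ℝ) := by
    have hR1 : 1 ≤ N / k := (Nat.le_div_iff_mul_le (by omega)).mpr (by omega)
    by_cases h5 : Real.log N ≤ 5
    · have : (1 : ℝ) ≤ ((harmonic (N / k) : ℚ) : ℝ) := by
        rw [← harm_Icc]
        have := Finset.single_le_sum (f := fun j : ℕ => (1 : ℝ) / j) (s := Finset.Icc 1 (N / k))
          (fun i _ => by positivity) (Finset.mem_Icc.mpr ⟨le_refl 1, hR1⟩)
        simpa using this
      linarith
    · push Not at h5
      refine le_trans ?_ (log_add_one_le_harmonic (N / k))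
      have hkk : (N : ℝ) ≤ k * ((N / k + 1 : ℕ) : ℝ) := by
        have := Nat.lt_mul_div_succ N (b := k) (by omega)
        exact_mod_cast this.le
      have hkn : (k : ℝ) ≤ 4 * Real.sqrt N := by
        have : L + 1 ≤ Real.sqrt N := Real.le_sqrt_of_sq_le hN1.le
        linarith
      have hp : (0 : ℝ) < ((N / k + 1 : ℕ) : ℝ) := by positivity
      have h6 := Real.log_le_log hN0 hkk
      rw [Real.log_mul hk0.ne' hp.ne'] at h6
      have h7 := Real.log_le_log hk0 hkn
      rw [Real.log_mul (by norm_num) (Real.sqrt_pos.mpr hN0).ne', Real.log_sqrt hN0.le,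
        show (4 : ℝ) = 2 ^ 2 by norm_num, Real.log_pow] at h7
      push_cast at h6 h7 ⊢
      linarith
  have hfac : (0 : ℝ) < (n.factorial : ℝ) / 2 := by positivity
  rw [div_le_iff₀ hfac] at hprop
  have h9 : ((harmonic (N / k) : ℚ) : ℝ) / (k : ℝ) * (1 - 1 / 2) ≤ altPropn n ε := by
    have := hgood'.trans hprop
    rw [mul_comm] at this
    exact le_of_mul_le_mul_right this hfac
  have h10 : ε / 20 ≤ ((harmonic (N / k) : ℚ) : ℝ) / (k : ℝ) := by
    rw [le_div_iff₀ hk0]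
    nlinarith
  have h11 : (2 / 3) * (ε / (16 * Real.log 2)) * (1 / Real.exp 1 - 1 / Real.sqrt n) < ε / 40 := by
    have hA : ε / (16 * Real.log 2) ≤ ε / (16 * (69 / 100)) := by
      apply div_le_div_of_nonneg_left hε0.le (by norm_num); linarith
    have hB : 1 / Real.exp 1 ≤ 1 / (27 / 10) := one_div_le_one_div_of_le (by norm_num) (by linarith)
    have hC : 0 < 1 / Real.sqrt n := by positivity
    calc (2 / 3) * (ε / (16 * Real.log 2)) * (1 / Real.exp 1 - 1 / Real.sqrt n)
        ≤ (2 / 3) * (ε / (16 * Real.log 2)) * (1 / (27 / 10)) :=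
          mul_le_mul_of_nonneg_left (by linarith) (by positivity)
      _ ≤ (2 / 3) * (ε / (16 * (69 / 100))) * (1 / (27 / 10)) := by gcongr
      _ < ε / 40 := by ring_nf; linarith
  linarith
end
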